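/- arXiv:2002.02736 — 2 statements merged into one kernel-verified Lean document; each statement's English description precedes it below -/
import Mathlib

section
/- Every balanced quasimodular form f of depth r ≤ 4 and weight w with (r+1)w ≡ 0 (mod 12) is a solution of a modular differential equation of the form ∂_{w−r}^{r+1} f + a_4 E_4 ∂_{w−r}^{r−1} f + a_6 E_6 ∂_{w−r}^{r−2} f + … + a_{2r+2} E_{2r+2} f = 0 with rational coefficients a_4, a_6, …, a_{2r+2} (where E_{2k} denotes the normalized Eisenstein series of weight 2k for 2 ≤ k ≤ r+1). -/
open Complex UpperHalfPlane Finset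
open scoped Manifold MatrixGroups Real

noncomputable section

/-- The nome `q = e^{2πiz}`. -/
def qexp (z : ℍ) : ℂ := Complex.exp (2 * Real.pi * Complex.I * z)

/-- The normalized Eisenstein series `E_k` (for even `k ≥ 2`), defined via its
`q`-expansion `E_k = 1 - (2k/B_k) ∑_{n ≥ 1} σ_{k-1}(n) q^n`. -/
def Eis (k : ℕ) (z : ℍ) : ℂ :=
  1 - (2 * k / ((bernoulli k : ℚ) : ℂ)) *
    ∑' n : ℕ, (ArithmeticFunction.sigma (k - 1) (n + 1) : ℂ) * qexp z ^ (n + 1)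

/-- The modular discriminant `Δ = (E_4³ − E_6²)/1728`. -/
def Disc (z : ℍ) : ℂ := (Eis 4 z ^ 3 - Eis 6 z ^ 2) / 1728

/-- The space of holomorphic modular forms of weight `w` for the full modular group,
as a set of functions on `ℍ`. -/
def Mset (w : ℤ) : Set (ℍ → ℂ) :=
  {f | ∃ F : ModularForm (⊤ : Subgroup SL(2, ℤ)) w, ⇑F = f}

/-- The set of quasimodular forms of weight `w` and depth `≤ r`:
functions of the form `∑_{ℓ=0}^r E_2^ℓ h_ℓ` with `h_ℓ ∈ M_{w-2ℓ}`. -/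
def QMset (w : ℤ) (r : ℕ) : Set (ℍ → ℂ) :=
  {f | ∃ h : ℕ → ℍ → ℂ, (∀ ℓ ≤ r, h ℓ ∈ Mset (w - 2 * ℓ)) ∧
        ∀ z, f z = ∑ ℓ ∈ Finset.range (r + 1), Eis 2 z ^ ℓ * h ℓ z}

/-- `QM_w^r` as a `ℂ`-subspace of the functions on `ℍ`. -/
def QM (w : ℤ) (r : ℕ) : Submodule ℂ (ℍ → ℂ) := Submodule.span ℂ (QMset w r)

/-- `dim QM_w^r`. -/
def dimQM (w : ℤ) (r : ℕ) : ℕ := Module.finrank ℂ (QM w r)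

/-- The complex derivative of a function on `ℍ` (via an extension to `ℂ`; since `ℍ` is
open in `ℂ` this agrees with the complex derivative for holomorphic `f`). -/
def hderiv (f : ℍ → ℂ) (z : ℍ) : ℂ :=
  deriv (fun w : ℂ => if h : 0 < w.im then f ⟨w, h⟩ else 0) z

/-- The normalized derivative `f' = (2πi)⁻¹ df/dz = q df/dq`. -/
def qderiv (f : ℍ → ℂ) (z : ℍ) : ℂ := (2 * Real.pi * Complex.I)⁻¹ * hderiv f z

/-- The Serre derivative `∂_w f = f' - (w/12) E_2 f`. -/
def serre (w : ℤ) (f : ℍ → ℂ) (z : ℍ) : ℂ :=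
  qderiv f z - ((w : ℂ) / 12) * Eis 2 z * f z

/-- Iterated Serre derivatives: `∂_w^0 f = f`, `∂_w^{k+1} f = ∂_{w+2k}(∂_w^k f)`. -/
def serreIter (w : ℤ) : ℕ → (ℍ → ℂ) → (ℍ → ℂ)
  | 0, f => f
  | (k + 1), f => serre (w + 2 * k) (serreIter w k f)

/-- `z ↦ -1/z` as a map `ℍ → ℍ`. -/
def Sact (z : ℍ) : ℍ :=
  ⟨-(z : ℂ)⁻¹, by
    have h0 : (z : ℂ) ≠ 0 := z.ne_zero
    have : (-(z : ℂ)⁻¹).im = (z : ℂ).im / Complex.normSq (z : ℂ) := by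
      rw [Complex.neg_im, Complex.inv_im]; ring
    rw [this]
    exact div_pos z.im_pos (Complex.normSq_pos.mpr h0)⟩

/-- `z ↦ z + 1` as a map `ℍ → ℍ`. -/
def Tact (z : ℍ) : ℍ := ⟨(z : ℂ) + 1, by simpa using z.im_pos⟩

/-- `g` has a `q`-expansion with vanishing order exactly `ν` at `i∞`:
`g = q^ν ∑_{n≥0} a(n) qⁿ` with `a(0) ≠ 0`. -/
def HasQExpansionAt (g : ℍ → ℂ) (ν : ℕ) : Prop :=
  ∃ a : ℕ → ℂ, a 0 ≠ 0 ∧ ∀ z : ℍ, HasSum (fun n : ℕ => a n * qexp z ^ (ν + n)) (g z)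

/-- The quasimodular forms `g_ℓ` attached to `f = ∑_{ℓ=0}^r E_2^ℓ h_ℓ`, defined by
`C(r,ℓ) g_ℓ = (6/(πi))^ℓ ∑_{m=0}^{r-ℓ} C(ℓ+m,m) E_2^m h_{ℓ+m}`. -/
def gOf (r : ℕ) (h : ℕ → ℍ → ℂ) (ℓ : ℕ) (z : ℍ) : ℂ :=
  ((r.choose ℓ : ℂ))⁻¹ * (6 / ((Real.pi : ℂ) * Complex.I)) ^ ℓ *
    ∑ m ∈ Finset.range (r - ℓ + 1), (((ℓ + m).choose m : ℕ) : ℂ) * Eis 2 z ^ m * h (ℓ + m) z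

/-- `f` is a balanced quasimodular form of weight `w` and depth `r`. -/
def IsBalancedQM (w : ℤ) (r : ℕ) (f : ℍ → ℂ) : Prop :=
  ∃ h : ℕ → ℍ → ℂ, ∃ lam : ℕ → ℕ,
    (∀ ℓ ≤ r, h ℓ ∈ Mset (w - 2 * ℓ)) ∧ h r ≠ 0 ∧
    (∀ z, f z = ∑ ℓ ∈ Finset.range (r + 1), Eis 2 z ^ ℓ * h ℓ z) ∧
    (∀ ℓ ≤ r, HasQExpansionAt (gOf r h ℓ) (lam ℓ)) ∧
    (∀ i j, i ≤ j → j ≤ r → lam j ≤ lam i) ∧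
    (∀ ℓ ≤ r, lam ℓ < dimQM (w - 2 * ℓ) (r - ℓ)) ∧
    (∑ ℓ ∈ Finset.range (r + 1), lam ℓ) = dimQM w r - 1

/-- `f` is the normalized extremal quasimodular form of weight `w` and depth `r`:
`f ∈ QM_w^r` with `q`-expansion `q^{dim QM_w^r - 1}(1 + O(q))`. -/
def IsNormalizedExtremalQM (w : ℤ) (r : ℕ) (f : ℍ → ℂ) : Prop :=
  f ∈ QM w r ∧ ∃ a : ℕ → ℂ, a 0 = 1 ∧
    ∀ z : ℍ, HasSum (fun n : ℕ => a n * qexp z ^ (dimQM w r - 1 + n)) (f z)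

/-- `f 0, …, f (n-1)` is a fundamental system of solutions of the linear differential
equation `K g = 0`: holomorphic linearly independent solutions spanning all
holomorphic solutions. -/
def IsFundamentalSystem {n : ℕ} (K : (ℍ → ℂ) → (ℍ → ℂ)) (f : Fin n → ℍ → ℂ) : Prop :=
  (∀ i, MDifferentiable 𝓘(ℂ) 𝓘(ℂ) (f i)) ∧ (∀ i, K (f i) = 0) ∧
    LinearIndependent ℂ f ∧
    ∀ g : ℍ → ℂ, MDifferentiable 𝓘(ℂ) 𝓘(ℂ) g → K g = 0 → g ∈ Submodule.span ℂ (Set.range f)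


/-- `F = (f_0, …, f_r)ᵀ` is a quasimodular vector of weight `w` and dimension `r+1`:
all components are holomorphic and there is a quasimodular form `f = ∑_{ℓ=0}^s E_2^ℓ h_ℓ`
of weight `w` and depth `s ≤ r` such that
`f_k(z) = ∑_{ℓ=0}^{min(k,s)} C(k,ℓ) z^{k-ℓ} g_ℓ(z)` for the attached forms `g_ℓ`. -/
def IsQuasimodularVector (w : ℤ) (r : ℕ) (F : Fin (r + 1) → ℍ → ℂ) : Prop :=
  (∀ k, MDifferentiable 𝓘(ℂ) 𝓘(ℂ) (F k)) ∧
  ∃ s : ℕ, s ≤ r ∧ ∃ h : ℕ → ℍ → ℂ,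
    (∀ ℓ ≤ s, h ℓ ∈ Mset (w - 2 * ℓ)) ∧ (s = 0 ∨ h s ≠ 0) ∧
    ∀ (k : Fin (r + 1)) (z : ℍ),
      F k z = ∑ ℓ ∈ Finset.range (min (k : ℕ) s + 1),
        (((k : ℕ).choose ℓ : ℕ) : ℂ) * (z : ℂ) ^ ((k : ℕ) - ℓ) * gOf s h ℓ z

/-- The modular Wronskian `W(z) = det(F, ∂_{w-r}F, …, ∂_{w-r}^r F)`. -/
def modularWronskian (w : ℤ) (r : ℕ) (F : Fin (r + 1) → ℍ → ℂ) (z : ℍ) : ℂ :=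
  Matrix.det (Matrix.of fun (k j : Fin (r + 1)) => serreIter (w - r) (j : ℕ) (F k) z)

end

namespace QuasiModular

open scoped ModularForm Topology
open Metric

section ModularForms

theorem map_mapGL_top :
    ((⊤ : Subgroup SL(2, ℤ)) : Subgroup (GL (Fin 2) ℝ)) = 𝒮ℒ :=
  (MonoidHom.range_eq_map _).symm

theorem mem_Mset_iff {k : ℤ} {f : ℍ → ℂ} :
    f ∈ Mset k ↔ ∃ F : ModularForm 𝒮ℒ k, ⇑F = f := by
  constructor
  · rintro ⟨F, rfl⟩
    exact ⟨F.mcast rfl map_mapGL_top.symm, rfl⟩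
  · rintro ⟨F, rfl⟩
    exact ⟨F.mcast rfl map_mapGL_top, rfl⟩

theorem mem_Mset_of_slash {k : ℤ} {f : ℍ → ℂ} (hS : f ∣[k] ModularGroup.S = f)
    (hT : f ∣[k] ModularGroup.T = f) (hf : MDiff f) (hb : IsBoundedAtImInfty f) : f ∈ Mset k := by
  have hγ := SlashInvariantForm.slash_action_generators_SL2Z hS hT
  refine mem_Mset_iff.mpr ⟨
    { toFun := f
      slash_action_eq' := ?_
      holo' := hf
      bdd_at_cusps' := fun hc => ?_ }, rfl⟩
  · rintro _ ⟨γ, rfl⟩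
    exact hγ γ
  · rw [OnePoint.isBoundedAt_iff_forall_SL2Z hc]
    intro γ _
    rwa [hγ γ]

theorem mdifferentiable_of_mem_Mset {k : ℤ} {f : ℍ → ℂ} (hf : f ∈ Mset k) : MDiff f := by
  obtain ⟨F, rfl⟩ := mem_Mset_iff.mp hf
  exact F.holo'

theorem slash_of_mem_Mset {k : ℤ} {f : ℍ → ℂ} (hf : f ∈ Mset k) (γ : SL(2, ℤ)) :
    f ∣[k] γ = f := by
  obtain ⟨F, rfl⟩ := mem_Mset_iff.mp hf
  exact F.slash_action_eq' _ ⟨γ, rfl⟩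

theorem add_mem_Mset {k : ℤ} {f g : ℍ → ℂ} (hf : f ∈ Mset k) (hg : g ∈ Mset k) :
    f + g ∈ Mset k := by
  obtain ⟨F, rfl⟩ := mem_Mset_iff.mp hf
  obtain ⟨G, rfl⟩ := mem_Mset_iff.mp hg
  exact mem_Mset_iff.mpr ⟨F + G, rfl⟩

theorem zero_mem_Mset (k : ℤ) : (0 : ℍ → ℂ) ∈ Mset k :=
  mem_Mset_iff.mpr ⟨0, rfl⟩

theorem smul_mem_Mset {k : ℤ} {f : ℍ → ℂ} (c : ℂ) (hf : f ∈ Mset k) : c • f ∈ Mset k := by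
  obtain ⟨F, rfl⟩ := mem_Mset_iff.mp hf
  exact mem_Mset_iff.mpr ⟨c • F, rfl⟩

theorem mul_mem_Mset {k l : ℤ} {f g : ℍ → ℂ} (hf : f ∈ Mset k) (hg : g ∈ Mset l) :
    f * g ∈ Mset (k + l) := by
  obtain ⟨F, rfl⟩ := mem_Mset_iff.mp hf
  obtain ⟨G, rfl⟩ := mem_Mset_iff.mp hg
  exact mem_Mset_iff.mpr ⟨F.mul G, rfl⟩

theorem one_mem_Mset : (1 : ℍ → ℂ) ∈ Mset 0 :=
  mem_Mset_iff.mpr ⟨1, rfl⟩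

theorem sum_mem_Mset {ι : Type*} {s : Finset ι} {k : ℤ} {f : ι → ℍ → ℂ}
    (hf : ∀ i ∈ s, f i ∈ Mset k) : ∑ i ∈ s, f i ∈ Mset k :=
  Finset.sum_induction _ (· ∈ Mset k) (fun _ _ => add_mem_Mset) (zero_mem_Mset k) hf

theorem prod_mem_Mset {ι : Type*} (s : Finset ι) {k : ι → ℤ} {f : ι → ℍ → ℂ}
    (hf : ∀ i ∈ s, f i ∈ Mset (k i)) : ∏ i ∈ s, f i ∈ Mset (∑ i ∈ s, k i) := by
  classical
  induction s using Finset.induction_on with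
  | empty => simpa using one_mem_Mset
  | insert a s ha ih =>
    rw [Finset.prod_insert ha, Finset.sum_insert ha]
    exact mul_mem_Mset (hf _ (Finset.mem_insert_self _ _))
      (ih fun i hi => hf i (Finset.mem_insert_of_mem hi))

/-- The determinant of a matrix of modular forms whose weights split as row weight plus column
weight is a modular form. -/
theorem det_mem_Mset {n : ℕ} {A : Matrix (Fin n) (Fin n) (ℍ → ℂ)} {a b : Fin n → ℤ}
    (hA : ∀ i j, A i j ∈ Mset (a i + b j)) : A.det ∈ Mset (∑ i, a i + ∑ j, b j) := by
  rw [Matrix.det_apply]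
  refine sum_mem_Mset fun σ _ => ?_
  have h := prod_mem_Mset Finset.univ (k := fun j => a (σ j) + b j) (f := fun j => A (σ j) j)
    fun j _ => hA _ _
  rw [Finset.sum_add_distrib, Equiv.sum_comp σ a] at h
  rcases Int.units_eq_one_or (Equiv.Perm.sign σ) with hσ | hσ
  · simpa [hσ] using h
  · simpa [hσ] using smul_mem_Mset (-1) h

theorem weight_of_mem_Mset {k : ℤ} {f : ℍ → ℂ} (hf : f ∈ Mset k) (hf0 : f ≠ 0) :
    Even k ∧ 0 ≤ k := by
  obtain ⟨F, rfl⟩ := mem_Mset_iff.mp hf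
  constructor
  · by_contra hk
    exact hf0 (by rw [ModularForm.levelOne_odd_weight_eq_zero (Int.not_even_iff_odd.mp hk) F]; rfl)
  · by_contra! hk
    exact hf0 (ModularFormClass.levelOne_neg_weight_eq_zero hk F)

end ModularForms

section LeadingTerm

theorem qexp_eq_qParam (z : ℍ) : qexp z = Function.Periodic.qParam 1 z := by
  simp [qexp, Function.Periodic.qParam]

theorem qexp_mem_ball (z : ℍ) : qexp z ∈ ball (0 : ℂ) 1 := by
  simpa [qexp_eq_qParam] using Function.Periodic.norm_qParam_lt_one one_pos z.im_pos

/-- `g = q ^ n * φ(q)` with `φ` holomorphic on the unit disc and `φ 0 = c`. -/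
def HasLead (g : ℍ → ℂ) (n : ℕ) (c : ℂ) : Prop :=
  ∃ φ : ℂ → ℂ, DifferentiableOn ℂ φ (ball 0 1) ∧ φ 0 = c ∧
    ∀ z, g z = qexp z ^ n * φ (qexp z)

namespace HasLead

variable {g g₁ g₂ : ℍ → ℂ} {n m : ℕ} {c c₁ c₂ : ℂ}

theorem add (h₁ : HasLead g₁ n c₁) (h₂ : HasLead g₂ n c₂) :
    HasLead (fun z => g₁ z + g₂ z) n (c₁ + c₂) := by
  obtain ⟨φ, hφ, rfl, hg⟩ := h₁
  obtain ⟨ψ, hψ, rfl, hg'⟩ := h₂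
  exact ⟨fun q => φ q + ψ q, hφ.add hψ, rfl, fun z => by simp only [hg, hg']; ring⟩

theorem mul (h₁ : HasLead g₁ n c₁) (h₂ : HasLead g₂ m c₂) :
    HasLead (fun z => g₁ z * g₂ z) (n + m) (c₁ * c₂) := by
  obtain ⟨φ, hφ, rfl, hg⟩ := h₁
  obtain ⟨ψ, hψ, rfl, hg'⟩ := h₂
  exact ⟨fun q => φ q * ψ q, hφ.mul hψ, rfl, fun z => by simp only [hg, hg']; ring⟩

theorem const (c : ℂ) : HasLead (fun _ => c) 0 c :=
  ⟨fun _ => c, differentiableOn_const c, rfl, fun z => by simp⟩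

theorem const_mul (a : ℂ) (h : HasLead g n c) : HasLead (fun z => a * g z) n (a * c) := by
  simpa using (const a).mul h

theorem sum {ι : Type*} {s : Finset ι} {g : ι → ℍ → ℂ} {c : ι → ℂ}
    (h : ∀ i ∈ s, HasLead (g i) n (c i)) :
    HasLead (fun z => ∑ i ∈ s, g i z) n (∑ i ∈ s, c i) := by
  choose! φ hφ hc hg using h
  refine ⟨fun q => ∑ i ∈ s, φ i q, DifferentiableOn.fun_sum hφ, Finset.sum_congr rfl hc,
    fun z => ?_⟩
  rw [Finset.mul_sum]
  exact Finset.sum_congr rfl fun i hi => hg i hi z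

theorem of_lt (h : HasLead g n c) (hmn : m < n) : HasLead g m 0 := by
  obtain ⟨φ, hφ, -, hg⟩ := h
  refine ⟨fun q => q ^ (n - m) * φ q, by fun_prop, by simp [Nat.sub_ne_zero_of_lt hmn],
    fun z => ?_⟩
  rw [hg, ← mul_assoc, ← pow_add, Nat.add_sub_cancel' hmn.le]

theorem succ (h : HasLead g n 0) : ∃ c, HasLead g (n + 1) c := by
  obtain ⟨φ, hφ, h0, hg⟩ := h
  have hball : ball (0 : ℂ) 1 ∈ 𝓝 (0 : ℂ) := ball_mem_nhds _ one_pos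
  refine ⟨_, dslope φ 0, (Complex.differentiableOn_dslope hball).mpr hφ, rfl, fun z => ?_⟩
  have := sub_smul_dslope φ 0 (qexp z)
  simp only [sub_zero, h0, smul_eq_mul] at this
  rw [hg, ← this]
  ring

/-- Row `i` of the matrix has leading exponent `n i`. -/
theorem det {N : ℕ} {A : Fin N → Fin N → ℍ → ℂ} {n : Fin N → ℕ} {c : Matrix (Fin N) (Fin N) ℂ}
    (h : ∀ i j, HasLead (A i j) (n i) (c i j)) :
    HasLead (fun z => (Matrix.of fun i j => A i j z).det) (∑ i, n i) c.det := by
  choose φ hφ hc hg using h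
  refine ⟨fun q => (Matrix.of fun i j => φ i j q).det, ?_, ?_, fun z => ?_⟩
  · simp only [Matrix.det_apply, Matrix.of_apply, Units.smul_def]
    exact DifferentiableOn.fun_sum fun σ _ =>
      (DifferentiableOn.fun_finsetProd fun i _ => hφ _ i).const_smul _
  · simp only [hc]
    rfl
  · rw [← Finset.prod_pow_eq_pow_sum, ← Matrix.det_mul_column]
    simp only [hg, Matrix.of_apply]

theorem of_hasSum {a : ℕ → ℂ} (h : ∀ z : ℍ, HasSum (fun k => a k * qexp z ^ (n + k)) (g z)) :
    HasLead g n (a 0) := by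
  have hs (q : ℂ) (hq : q ∈ ball (0 : ℂ) 1) : Summable fun k => a k * q ^ k := by
    rcases eq_or_ne q 0 with rfl | hq0
    · exact summable_of_ne_finset_zero (s := {0}) fun k hk => by
        simp [show k ≠ 0 by simpa using hk]
    · have hpos := Function.Periodic.im_invQParam_pos_of_norm_lt_one one_pos
        (mem_ball_zero_iff.mp hq) hq0
      have hqz : qexp ⟨_, hpos⟩ = q := by
        rw [qexp_eq_qParam]
        exact Function.Periodic.qParam_right_inv one_ne_zero hq0
      have := (h ⟨_, hpos⟩).summable
      rw [hqz] at this
      refine (this.mul_left (q ^ n)⁻¹).congr fun k => ?_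
      field_simp
      ring
  have hrad : 1 ≤ (FormalMultilinearSeries.ofScalars ℂ a).radius := by
    refine le_of_forall_lt_imp_le_of_dense fun r hr => ?_
    lift r to NNReal using hr.ne_top
    apply FormalMultilinearSeries.le_radius_of_summable
    simpa [norm_mul, norm_pow] using (hs r (by simpa using hr)).norm
  have hφ := (FormalMultilinearSeries.ofScalars ℂ a).hasFPowerSeriesOnBall
    (one_pos.trans_le hrad)
  refine ⟨fun q => ∑' k, a k * q ^ k, ?_, ?_, fun z => ?_⟩
  · have := hφ.differentiableOn.mono (Metric.eball_subset_eball hrad)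
    rw [← ENNReal.coe_one, Metric.eball_coe, NNReal.coe_one] at this
    refine this.congr fun q _ => ?_
    simp [FormalMultilinearSeries.sum, mul_comm]
  · exact (tsum_eq_single 0 fun k hk => by simp [hk]).trans (by simp)
  · rw [← (h z).tsum_eq, ← tsum_mul_left]
    exact tsum_congr fun k => by ring

theorem hasDerivAt (h : HasLead g n c) : ∃ h' : ℍ → ℂ, HasLead h' n (n * c) ∧
    ∀ z : ℍ, HasDerivAt (g ∘ ofComplex) (2 * π * Complex.I * h' z) z := by
  obtain ⟨φ, hφ, rfl, hg⟩ := h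
  refine ⟨fun z => qexp z ^ n * (n * φ (qexp z) + qexp z * deriv φ (qexp z)),
    ⟨fun q => n * φ q + q * deriv φ q,
      (hφ.const_mul _).add (differentiableOn_id.mul (hφ.deriv isOpen_ball)), by simp,
      fun z => rfl⟩, fun z => ?_⟩
  have hexp : HasDerivAt (fun w : ℂ => Complex.exp (2 * π * Complex.I * w))
      (2 * π * Complex.I * qexp z) z := by
    simpa [qexp, mul_comm] using ((hasDerivAt_id (z : ℂ)).const_mul (2 * π * Complex.I)).cexp
  have hφ' : HasDerivAt φ (deriv φ (qexp z)) (qexp z) :=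
    (hφ.differentiableAt (isOpen_ball.mem_nhds (qexp_mem_ball z))).hasDerivAt
  have hev : g ∘ ofComplex =ᶠ[𝓝 (z : ℂ)]
      fun w => Complex.exp (2 * π * Complex.I * w) ^ n * φ (Complex.exp (2 * π * Complex.I * w)) := by
    filter_upwards [isOpen_upperHalfPlaneSet.mem_nhds z.im_pos] with w hw
    simp [hg, qexp, ofComplex_apply_of_im_pos hw]
  refine HasDerivAt.congr_of_eventuallyEq ?_ hev
  have := (hexp.pow n).mul (hφ'.comp (z : ℂ) hexp)
  refine this.congr_deriv ?_
  simp only [Function.comp_apply]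
  change _ * qexp z ^ (n - 1) * _ * φ (qexp z) + qexp z ^ n * _ = _
  rcases n with _ | n
  · simp
    ring
  · simp
    ring

theorem mdifferentiable (h : HasLead g n c) : MDiff g := by
  obtain ⟨h', -, hd⟩ := h.hasDerivAt
  exact fun z => mdifferentiableAt_iff.mpr (hd z).differentiableAt

theorem tendsto (h : HasLead g 0 c) : Filter.Tendsto g atImInfty (𝓝 c) := by
  obtain ⟨φ, hφ, rfl, hg⟩ := h
  have hcont : ContinuousAt φ 0 :=
    (hφ.differentiableAt (ball_mem_nhds _ one_pos)).continuousAt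
  have := hcont.tendsto.comp (qParam_tendsto_atImInfty one_pos)
  refine this.congr fun z => ?_
  simp [hg, qexp_eq_qParam]

theorem isBoundedAtImInfty (h : HasLead g 0 c) : IsBoundedAtImInfty g :=
  h.tendsto.isBigO_one ℝ

theorem of_mem_Mset {k : ℤ} (hg : g ∈ Mset k) : ∃ c, HasLead g 0 c := by
  obtain ⟨F, rfl⟩ := mem_Mset_iff.mp hg
  refine ⟨_, of_hasSum (a := fun m => (qExpansion 1 F).coeff m) fun z => ?_⟩
  simpa [qexp_eq_qParam] using
    ModularForm.hasSum_qExpansion F one_pos one_mem_strictPeriods_SL z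

/-- A modular form of weight `k` vanishing to order more than `k / 12` is zero. -/
theorem eq_zero_of_mem_Mset {k : ℤ} (h : HasLead g n c) (hg : g ∈ Mset k) (hn : 0 < n)
    (hk : k < 12 * n) : g = 0 := by
  obtain ⟨F, rfl⟩ := mem_Mset_iff.mp hg
  obtain ⟨φ, hφ, -, hgφ⟩ := h
  let b : ℕ → ℂ := fun m => (m.factorial : ℂ)⁻¹ * iteratedDeriv m φ 0
  let a : ℕ → ℂ := fun m => if m < n then 0 else b (m - n)
  have ha (z : ℍ) : HasSum (fun m => a m • Function.Periodic.qParam 1 z ^ m) (F z) := by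
    rw [← hasSum_nat_add_iff' n, Finset.sum_eq_zero fun m hm => by
      simp [a, Finset.mem_range.mp hm], sub_zero, hgφ z]
    have := (Complex.hasSum_taylorSeries_on_ball hφ (qexp_mem_ball z)).mul_left (qexp z ^ n)
    refine Eq.subst (motive := (HasSum · _)) (funext fun m => ?_) this
    simp only [a, b, Nat.add_sub_cancel, qexp_eq_qParam, sub_zero, smul_eq_mul,
      Nat.not_lt.mpr (Nat.le_add_left n m), if_false, pow_add]
    ring
  have hcoeff := ModularFormClass.qExpansion_coeff_unique one_pos one_mem_strictPeriods_SL ha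
  have hord : (n : ℕ∞) ≤ (qExpansion 1 F).order := by
    refine PowerSeries.le_order _ _ fun m hm => ?_
    rw [← hcoeff m]
    simp [a, Nat.cast_lt.mp hm]
  rw [ModularForm.sturm_bound_levelOne (f := F) (lt_of_lt_of_le ?_ hord)]
  · rfl
  · exact Nat.cast_lt.mpr (by omega)

theorem eq_zero_of_mul_eq_zero (h₁ : HasLead g₁ n c₁) (hc : c₁ ≠ 0) (h₂ : HasLead g₂ m c₂)
    (h : ∀ z, g₁ z * g₂ z = 0) : g₂ = 0 := by
  obtain ⟨φ, hφ, rfl, hg⟩ := h₁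
  obtain ⟨ψ, hψ, -, hg'⟩ := h₂
  have hball : ball (0 : ℂ) 1 ∈ 𝓝 (0 : ℂ) := ball_mem_nhds _ one_pos
  have hφ0 : ∀ᶠ q in 𝓝 (0 : ℂ), φ q ≠ 0 :=
    (hφ.differentiableAt hball).continuousAt.eventually_ne hc
  have hψ0 : ∃ᶠ q in 𝓝[≠] (0 : ℂ), ψ q = 0 := by
    refine Filter.Eventually.frequently ?_
    filter_upwards [nhdsWithin_le_nhds hφ0, nhdsWithin_le_nhds hball, self_mem_nhdsWithin]
      with q hq hq1 hq0
    have hpos := Function.Periodic.im_invQParam_pos_of_norm_lt_one one_pos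
      (mem_ball_zero_iff.mp hq1) hq0
    have hqz : qexp ⟨_, hpos⟩ = q := by
      rw [qexp_eq_qParam]
      exact Function.Periodic.qParam_right_inv one_ne_zero hq0
    have := h ⟨_, hpos⟩
    rw [hg, hg', hqz] at this
    simpa [hq, show q ≠ 0 from hq0] using this
  have := (hψ.analyticOnNhd isOpen_ball).eqOn_zero_of_preconnected_of_frequently_eq_zero
    (convex_ball _ _).isPreconnected (mem_ball_self one_pos) hψ0
  ext z
  simp [hg', this (qexp_mem_ball z)]

end HasLead

theorem qderiv_eq (f : ℍ → ℂ) : qderiv f = Derivative.normalizedDerivOfComplex f := by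
  ext z
  rw [qderiv, hderiv, Derivative.normalizedDerivOfComplex]
  congr 1
  refine Filter.EventuallyEq.deriv_eq ?_
  filter_upwards [isOpen_upperHalfPlaneSet.mem_nhds z.im_pos] with w hw
  have hw' : 0 < w.im := hw
  simp [hw', ofComplex_apply_of_im_pos hw']

theorem HasLead.qderiv {g : ℍ → ℂ} {n : ℕ} {c : ℂ} (h : HasLead g n c) :
    HasLead (qderiv g) n (n * c) := by
  obtain ⟨h', hl, hd⟩ := h.hasDerivAt
  convert hl using 1
  ext z
  rw [qderiv_eq, Derivative.normalizedDerivOfComplex, (hd z).deriv,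
    inv_mul_cancel_left₀ Complex.two_pi_I_ne_zero]

end LeadingTerm

section Eisenstein

theorem summable_sigma_mul_qexp {k : ℕ} (hk : 1 ≤ k) (z : ℍ) :
    Summable fun n : ℕ => (ArithmeticFunction.sigma (k - 1) (n + 1) : ℂ) * qexp z ^ (n + 1) :=
  (summable_nat_add_iff 1).mpr (EisensteinSeries.summable_sigma_mul_cexp_pow hk z)

theorem hasLead_Eis {k : ℕ} (hk : 1 ≤ k) : HasLead (Eis k) 0 1 := by
  let a : ℕ → ℂ := fun n => if n = 0 then 1 else
    -(2 * k / ((bernoulli k : ℚ) : ℂ)) * (ArithmeticFunction.sigma (k - 1) n : ℂ)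
  refine HasLead.of_hasSum (a := a) fun z => ?_
  rw [← hasSum_nat_add_iff' 1]
  have := (summable_sigma_mul_qexp hk z).hasSum.mul_left (-(2 * k / ((bernoulli k : ℚ) : ℂ)))
  have hv : Eis k z - ∑ i ∈ range 1, a i * qexp z ^ (0 + i) =
      -(2 * k / ((bernoulli k : ℚ) : ℂ)) *
        ∑' n : ℕ, (ArithmeticFunction.sigma (k - 1) (n + 1) : ℂ) * qexp z ^ (n + 1) := by
    simp [Eis, a]
  rw [hv]
  refine Eq.subst (motive := (HasSum · _)) (funext fun n => ?_) this
  simp [a, mul_assoc]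

theorem tsum_pnat_sigma (k : ℕ) (z : ℍ) :
    ∑' n : ℕ+, (ArithmeticFunction.sigma (k - 1) n : ℂ) * qexp z ^ (n : ℕ) =
      ∑' n : ℕ, (ArithmeticFunction.sigma (k - 1) (n + 1) : ℂ) * qexp z ^ (n + 1) :=
  tsum_pnat_eq_tsum_succ (f := fun n => (ArithmeticFunction.sigma (k - 1) n : ℂ) * qexp z ^ n)

theorem Eis_two : Eis 2 = EisensteinSeries.E2 := by
  ext z
  rw [EisensteinSeries.E2_eq_tsum_cexp, Eis, bernoulli_two]
  have := tsum_pnat_sigma 2 z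
  simp only [qexp] at this ⊢
  rw [← this]
  norm_num

theorem Eis_mem_Mset {k : ℕ} (hk : 3 ≤ k) (hk2 : Even k) : Eis k ∈ Mset k := by
  have h : (⇑(ModularForm.E hk) : ℍ → ℂ) = Eis k := by
    ext z
    rw [EisensteinSeries.q_expansion_bernoulli hk hk2, Eis, ← tsum_pnat_sigma]
    simp [qexp]
  exact mem_Mset_iff.mpr ⟨ModularForm.E hk, h⟩

theorem serre_eq (k : ℤ) (f : ℍ → ℂ) : serre k f = Derivative.serreDerivative k f := by
  ext z
  simp [serre, qderiv_eq, Eis_two, div_eq_mul_inv]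

theorem HasLead.serre {g : ℍ → ℂ} {n : ℕ} {c : ℂ} (h : HasLead g n c) (k : ℤ) :
    HasLead (serre k g) n ((n - k / 12) * c) := by
  have hE := (hasLead_Eis one_le_two).mul h
  rw [zero_add] at hE
  have := h.qderiv.add (hE.const_mul (-(k / 12 : ℂ)))
  convert this using 1
  · ext z
    simp only [_root_.serre]
    ring
  · ring

theorem serre_mem_Mset {k : ℤ} {f : ℍ → ℂ} (hf : f ∈ Mset k) : serre k f ∈ Mset (k + 2) := by
  have hd := mdifferentiable_of_mem_Mset hf
  obtain ⟨c, hc⟩ := HasLead.of_mem_Mset hf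
  have hs (γ : SL(2, ℤ)) : serre k f ∣[k + 2] γ = serre k f := by
    rw [serre_eq]
    exact Derivative.serreDerivative_slash_invariant hd (slash_of_mem_Mset hf γ)
  exact mem_Mset_of_slash (hs _) (hs _) (hc.serre k).mdifferentiable
    (hc.serre k).isBoundedAtImInfty

/-- The Serre derivative of weight one of `E₂`, a modular form of weight four. -/
noncomputable def serreEisTwo : ℍ → ℂ := serre 1 (Eis 2)

theorem Eis_two_slash_S : Eis 2 ∣[(2 : ℤ)] ModularGroup.S =
    Eis 2 + fun z : ℍ => -(6 * Complex.I / π) / z := by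
  rw [Eis_two, EisensteinSeries.E2_slash_action]
  ext z
  have hpi : (π : ℂ) ≠ 0 := by simp
  have hz := z.ne_zero
  simp only [Pi.sub_apply, Pi.smul_apply, EisensteinSeries.D2_S, riemannZeta_two, smul_eq_mul,
    Pi.add_apply]
  field_simp
  ring

theorem Eis_two_slash_T : Eis 2 ∣[(2 : ℤ)] ModularGroup.T = Eis 2 := by
  rw [Eis_two, EisensteinSeries.E2_slash_action, EisensteinSeries.D2_T]
  simp

theorem serreEisTwo_slash {γ : SL(2, ℤ)} {ψ : ℍ → ℂ} (hψ : MDiff ψ)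
    (h : Eis 2 ∣[(2 : ℤ)] γ = Eis 2 + ψ)
    (hd : ∀ z, Derivative.normalizedDerivOfComplex ψ z = -(ψ z ^ 2 / 12)) :
    serreEisTwo ∣[(4 : ℤ)] γ = serreEisTwo := by
  have hE : MDiff (Eis 2) := (hasLead_Eis one_le_two).mdifferentiable
  have hdec : serreEisTwo = Derivative.serreDerivative ((2 : ℤ) : ℂ) (Eis 2) +
      (1 / 12 : ℂ) • (Eis 2 * Eis 2) := by
    ext z
    simp [serreEisTwo, serre_eq, Eis_two]
    ring
  have heq := Derivative.serreDerivative_slash_equivariant (k := 2) hE (γ := γ)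
  have hmul := ModularForm.mul_slash_SL2 2 2 γ (Eis 2) (Eis 2)
  norm_num at heq hmul
  rw [hdec, SlashAction.add_slash, ModularForm.SL_smul_slash]
  norm_num
  rw [heq, hmul, h, Derivative.normalizedDerivOfComplex_add _ _ hE hψ]
  ext z
  simp [hd, Eis_two]
  ring

theorem serreEisTwo_mem_Mset : serreEisTwo ∈ Mset 4 := by
  have hl : HasLead serreEisTwo 0 _ := (hasLead_Eis one_le_two).serre 1
  have hder (z : ℍ) : HasDerivAt ((fun z : ℍ => -(6 * Complex.I / π) / (z : ℂ)) ∘ ofComplex)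
      (6 * Complex.I / π / (z : ℂ) ^ 2) z := by
    have h1 := (hasDerivAt_inv z.ne_zero).const_mul (-(6 * Complex.I / π))
    refine (h1.congr_of_eventuallyEq ?_).congr_deriv ?_
    · filter_upwards [isOpen_upperHalfPlaneSet.mem_nhds z.im_pos] with w hw
      simp [ofComplex_apply_of_im_pos hw, div_eq_mul_inv]
    · ring
  refine mem_Mset_of_slash ?_ ?_ hl.mdifferentiable hl.isBoundedAtImInfty
  · refine serreEisTwo_slash (fun z => mdifferentiableAt_iff.mpr (hder z).differentiableAt)
      Eis_two_slash_S fun z => ?_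
    rw [Derivative.normalizedDerivOfComplex, (hder z).deriv]
    have hpi : (π : ℂ) ≠ 0 := by simp
    have hz := z.ne_zero
    field_simp
    norm_num
  · refine serreEisTwo_slash (ψ := 0) mdifferentiable_const (by simpa using Eis_two_slash_T)
      fun z => ?_
    have := Derivative.normalizedDerivOfComplex_const 0
    exact (congr_fun this z).trans (by simp)

end Eisenstein

section Coefficients

theorem hasDerivAt_qderiv {f : ℍ → ℂ} (hf : MDiff f) (z : ℍ) :
    HasDerivAt (f ∘ ofComplex) (2 * π * Complex.I * qderiv f z) z := by
  rw [qderiv_eq, Derivative.normalizedDerivOfComplex,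
    mul_inv_cancel_left₀ Complex.two_pi_I_ne_zero]
  exact (mdifferentiableAt_iff.mp (hf z)).hasDerivAt

theorem qderiv_eq_of_hasDerivAt {f : ℍ → ℂ} {z : ℍ} {c : ℂ}
    (h : HasDerivAt (f ∘ ofComplex) (2 * π * Complex.I * c) z) : qderiv f z = c := by
  rw [qderiv_eq, Derivative.normalizedDerivOfComplex, h.deriv,
    inv_mul_cancel_left₀ Complex.two_pi_I_ne_zero]

theorem qderiv_sum_pow_mul {ι : Type*} (s : Finset ι) (c : ι → ℂ) (m : ι → ℕ) {f : ℍ → ℂ}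
    {h : ι → ℍ → ℂ} (hf : MDiff f) (hh : ∀ i, MDiff (h i)) (z : ℍ) :
    qderiv (fun z => ∑ i ∈ s, c i * f z ^ m i * h i z) z =
      ∑ i ∈ s, c i * (m i * f z ^ (m i - 1) * qderiv f z * h i z + f z ^ m i * qderiv (h i) z) := by
  have := HasDerivAt.fun_sum (u := s) fun i _ =>
    (((hasDerivAt_qderiv hf z).pow (m i)).const_mul (c i)).mul (hasDerivAt_qderiv (hh i) z)
  refine qderiv_eq_of_hasDerivAt (this.congr_deriv ?_)
  rw [Finset.mul_sum]
  refine Finset.sum_congr rfl fun i _ => ?_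
  simp only [Function.comp_apply, ofComplex_apply, Pi.pow_apply]
  ring

/-- The sequence shifted by one place, with a zero in front. -/
def shiftSeq {α : Type*} [Zero α] (u : ℕ → α) : ℕ → α
  | 0 => 0
  | n + 1 => u n

/-- The coefficients, as a polynomial in `E₂`, of the Serre derivative of weight `w - r` of
`∑ E₂ ^ ℓ * h ℓ`. -/
noncomputable def coeffSerre (w : ℤ) (r : ℕ) (h : ℕ → ℍ → ℂ) (ℓ : ℕ) : ℍ → ℂ :=
  serre (w - 2 * ℓ) (h ℓ) + (ℓ + 1 : ℂ) • (serreEisTwo * h (ℓ + 1)) +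
    ((r - ℓ + 1) / 12 : ℂ) • shiftSeq h ℓ

/-- The form `∑ C(k, ℓ) * E₂ ^ (k - ℓ) * h k`, proportional to the attached form `g_ℓ`. -/
noncomputable def attached (r : ℕ) (h : ℕ → ℍ → ℂ) (ℓ : ℕ) (z : ℍ) : ℂ :=
  ∑ k ∈ range (r + 1), (k.choose ℓ : ℂ) * Eis 2 z ^ (k - ℓ) * h k z

variable {w : ℤ} {r : ℕ} {h : ℕ → ℍ → ℂ}

theorem serre_zero (k : ℤ) : serre k 0 = 0 := by
  ext z
  have : qderiv 0 z = 0 := by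
    rw [qderiv_eq]
    exact congr_fun (Derivative.normalizedDerivOfComplex_const 0) z
  simp [serre, this]

theorem coeffSerre_mem_Mset (hh : ∀ ℓ : ℕ, h ℓ ∈ Mset (w - 2 * ℓ)) (ℓ : ℕ) :
    coeffSerre w r h ℓ ∈ Mset (w + 2 - 2 * ℓ) := by
  refine add_mem_Mset (add_mem_Mset ?_ (smul_mem_Mset _ ?_)) (smul_mem_Mset _ ?_)
  · rw [show w + 2 - 2 * (ℓ : ℤ) = w - 2 * ℓ + 2 by ring]
    exact serre_mem_Mset (hh ℓ)
  · rw [show w + 2 - 2 * (ℓ : ℤ) = 4 + (w - 2 * ((ℓ + 1 : ℕ) : ℤ)) by push_cast; ring]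
    exact mul_mem_Mset serreEisTwo_mem_Mset (hh (ℓ + 1))
  · rcases ℓ with _ | ℓ
    · exact zero_mem_Mset _
    · rw [show w + 2 - 2 * ((ℓ + 1 : ℕ) : ℤ) = w - 2 * ℓ by push_cast; ring]
      exact hh ℓ

theorem coeffSerre_eq_zero (h0 : ∀ ℓ, r < ℓ → h ℓ = 0) {ℓ : ℕ} (hℓ : r < ℓ) :
    coeffSerre w r h ℓ = 0 := by
  rw [coeffSerre, h0 ℓ hℓ, h0 (ℓ + 1) (by omega), serre_zero]
  rcases ℓ with _ | ℓ
  · omega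
  · rcases (Nat.lt_succ_iff.mp hℓ).eq_or_lt with rfl | hlt
    · simp
    · simp [shiftSeq, h0 ℓ hlt]

theorem attached_coeffSerre (hr : r ≤ 4) (hh : ∀ ℓ, MDiff (h ℓ)) (h0 : ∀ ℓ, r < ℓ → h ℓ = 0)
    {ℓ : ℕ} (hℓ : ℓ ≤ r) (z : ℍ) :
    attached r (coeffSerre w r h) ℓ z = serre (w - r) (attached r h ℓ) z +
      ((r - ℓ + 1) / 12 : ℂ) * shiftSeq (attached r h) ℓ z := by
  have hE : MDiff (Eis 2) := (hasLead_Eis one_le_two).mdifferentiable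
  have hE' : qderiv (Eis 2) z = serreEisTwo z + Eis 2 z ^ 2 / 12 := by
    simp only [serreEisTwo, serre]
    push_cast
    ring
  have hS (k : ℕ) : qderiv (h k) z = serre (w - 2 * k) (h k) z +
      (w - 2 * k) / 12 * Eis 2 z * h k z := by
    simp only [serre]
    push_cast
    ring
  have h0' := congr_fun (h0 (r + 1) r.lt_succ_self) z
  simp only [Pi.zero_apply] at h0'
  rw [serre]
  simp only [show attached r h ℓ = fun z => ∑ k ∈ range (r + 1),
    (k.choose ℓ : ℂ) * Eis 2 z ^ (k - ℓ) * h k z from rfl]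
  rw [qderiv_sum_pow_mul _ _ _ hE hh]
  simp only [hS, hE', attached, coeffSerre, Pi.add_apply, Pi.smul_apply, Pi.mul_apply, smul_eq_mul]
  interval_cases r <;> interval_cases ℓ <;>
    simp [Finset.sum_range_succ, shiftSeq, attached, Nat.choose, h0'] <;> ring

theorem gOf_eq {ℓ : ℕ} (hℓ : ℓ ≤ r) (z : ℍ) :
    gOf r h ℓ z = (r.choose ℓ : ℂ)⁻¹ * (6 / (π * Complex.I)) ^ ℓ * attached r h ℓ z := by
  have hsum : attached r h ℓ z = ∑ m ∈ range (r - ℓ + 1),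
      (((ℓ + m).choose m : ℕ) : ℂ) * Eis 2 z ^ m * h (ℓ + m) z := by
    rw [attached, range_eq_Ico, ← Finset.sum_Ico_consecutive _ (Nat.zero_le ℓ) (by omega),
      Finset.sum_eq_zero (s := Ico 0 ℓ) fun k hk => by
        simp [Nat.choose_eq_zero_of_lt (Finset.mem_Ico.mp hk).2], zero_add,
      Finset.sum_Ico_eq_sum_range _ ℓ, show r + 1 - ℓ = r - ℓ + 1 by omega]
    refine Finset.sum_congr rfl fun m _ => ?_
    rw [Nat.choose_symm_add, Nat.add_sub_cancel_left]
  rw [gOf, hsum]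

variable (w r h) in
/-- The coefficients of the iterated Serre derivatives. -/
noncomputable def coeffIter : ℕ → ℕ → ℍ → ℂ
  | 0 => h
  | j + 1 => coeffSerre (w + 2 * j) r (coeffIter j)

theorem coeffIter_mem_Mset (hh : ∀ ℓ : ℕ, h ℓ ∈ Mset (w - 2 * ℓ)) (j ℓ : ℕ) :
    coeffIter w r h j ℓ ∈ Mset (w + 2 * j - 2 * ℓ) := by
  induction j generalizing ℓ with
  | zero => simpa [coeffIter] using hh ℓ
  | succ j ih =>
    rw [show w + 2 * ((j + 1 : ℕ) : ℤ) - 2 * ℓ = w + 2 * j + 2 - 2 * ℓ by push_cast; ring]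
    exact coeffSerre_mem_Mset ih ℓ

theorem coeffIter_eq_zero (h0 : ∀ ℓ, r < ℓ → h ℓ = 0) (j : ℕ) {ℓ : ℕ} (hℓ : r < ℓ) :
    coeffIter w r h j ℓ = 0 := by
  induction j generalizing ℓ with
  | zero => exact h0 ℓ hℓ
  | succ j ih => exact coeffSerre_eq_zero (fun _ => ih) hℓ

theorem attached_coeffIter_succ (hr : r ≤ 4) (hh : ∀ ℓ : ℕ, h ℓ ∈ Mset (w - 2 * ℓ))
    (h0 : ∀ ℓ, r < ℓ → h ℓ = 0) (j : ℕ) {ℓ : ℕ} (hℓ : ℓ ≤ r) (z : ℍ) :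
    attached r (coeffIter w r h (j + 1)) ℓ z =
      serre (w - r + 2 * j) (attached r (coeffIter w r h j) ℓ) z +
      ((r - ℓ + 1) / 12 : ℂ) * shiftSeq (attached r (coeffIter w r h j)) ℓ z := by
  rw [show w - r + 2 * j = w + 2 * j - r by ring]
  exact attached_coeffSerre hr
    (fun ℓ => mdifferentiable_of_mem_Mset (coeffIter_mem_Mset hh j ℓ))
    (fun ℓ => coeffIter_eq_zero h0 j) hℓ z

theorem attached_coeffIter_zero (hr : r ≤ 4) (hh : ∀ ℓ : ℕ, h ℓ ∈ Mset (w - 2 * ℓ))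
    (h0 : ∀ ℓ, r < ℓ → h ℓ = 0) (j : ℕ) :
    attached r (coeffIter w r h j) 0 = serreIter (w - r) j (attached r h 0) := by
  induction j with
  | zero => rfl
  | succ j ih =>
    ext z
    rw [attached_coeffIter_succ hr hh h0 j (Nat.zero_le r), serreIter, ih]
    simp [shiftSeq]

end Coefficients

section LinearAlgebra

open Polynomial

variable {K : Type*} [Field K]

/-- The monic polynomial with roots `c 0, …, c (n - 1)`. -/
noncomputable def rootPoly (c : ℕ → K) (n : ℕ) : K[X] := ∏ i ∈ range n, (X - C (c i))

theorem rootPoly_succ (c : ℕ → K) (n : ℕ) :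
    rootPoly c (n + 1) = (X - C (c n)) * rootPoly c n := by
  rw [rootPoly, prod_range_succ, mul_comm, rootPoly]

theorem monic_rootPoly (c : ℕ → K) (n : ℕ) : (rootPoly c n).Monic :=
  monic_prod_of_monic _ _ fun _ _ => monic_X_sub_C _

theorem degree_rootPoly (c : ℕ → K) (n : ℕ) : (rootPoly c n).degree = n := by
  simp [rootPoly, degree_prod]

theorem natDegree_rootPoly (c : ℕ → K) (n : ℕ) : (rootPoly c n).natDegree = n :=
  natDegree_eq_of_degree_eq_some (degree_rootPoly c n)

theorem exists_sum_rootPoly (c : ℕ → K) (n : ℕ) {P : K[X]} (hP : P.degree < n) :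
    ∃ b : ℕ → K, P = ∑ j ∈ range n, b j • rootPoly c j := by
  induction n generalizing P with
  | zero => exact ⟨0, by simpa [Nat.WithBot.lt_zero_iff] using hP⟩
  | succ n ih =>
    have hn := (monic_rootPoly c n).coeff_natDegree
    rw [natDegree_rootPoly] at hn
    have hdeg : (P - P.coeff n • rootPoly c n).degree < n := by
      rw [degree_lt_iff_coeff_zero] at hP ⊢
      intro m hm
      rcases hm.eq_or_lt with rfl | hlt
      · simp [hn]
      · have : (rootPoly c n).coeff m = 0 :=
          coeff_eq_zero_of_natDegree_lt (by rwa [natDegree_rootPoly])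
        simp [hP m hlt, this]
    obtain ⟨b, hb⟩ := ih hdeg
    refine ⟨Function.update b n (P.coeff n), ?_⟩
    rw [sum_range_succ, Function.update_self, Finset.sum_congr rfl fun j hj => by
      rw [Function.update_of_ne (Finset.mem_range.mp hj).ne], ← hb, sub_add_cancel]

theorem linearIndependent_rootPoly (c : ℕ → K) : LinearIndependent K (rootPoly c) :=
  Polynomial.Sequence.linearIndependent
    (⟨rootPoly c, degree_rootPoly c⟩ : Polynomial.Sequence K)

/-- If the two monic polynomials have the same sum of roots, their difference is a combination of
terms of codegree at least two. -/
theorem rootPoly_eq_add_sum {a c : ℕ → K} {r : ℕ}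
    (h : ∑ i ∈ range (r + 1), a i = ∑ i ∈ range (r + 1), c i) :
    ∃ b : ℕ → K, rootPoly a (r + 1) = rootPoly c (r + 1) + ∑ j ∈ range r, b j • rootPoly c j := by
  have hdeg : (rootPoly a (r + 1) - rootPoly c (r + 1)).degree < r := by
    rw [degree_lt_iff_coeff_zero]
    intro m hm
    have hco (x : ℕ → K) : (rootPoly x (r + 1)).coeff r = -∑ i ∈ range (r + 1), x i := by
      simpa [rootPoly] using prod_X_sub_C_coeff_card_pred (range (r + 1)) x (by simp)
    have hco' (x : ℕ → K) : (rootPoly x (r + 1)).coeff (r + 1) = 1 := by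
      simpa [natDegree_rootPoly] using (monic_rootPoly x (r + 1)).coeff_natDegree
    rcases hm.eq_or_lt with rfl | hlt
    · simp [hco, h]
    · rcases (Nat.succ_le_of_lt hlt).eq_or_lt with rfl | hlt
      · simp [hco']
      · rw [coeff_sub, coeff_eq_zero_of_natDegree_lt (by rwa [natDegree_rootPoly]),
          coeff_eq_zero_of_natDegree_lt (by rwa [natDegree_rootPoly]), sub_zero]
  obtain ⟨b, hb⟩ := exists_sum_rootPoly c r hdeg
  exact ⟨b, by rw [← hb, add_sub_cancel]⟩

/-- The lower bidiagonal operator with diagonal `a` and subdiagonal `d`. -/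
def bidiag (a d : ℕ → K) : Module.End K (ℕ → K) where
  toFun u ℓ := a ℓ * u ℓ + d ℓ * shiftSeq u ℓ
  map_add' u v := by
    ext (_ | ℓ) <;> simp [shiftSeq] <;> ring
  map_smul' c u := by
    ext (_ | ℓ) <;> simp [shiftSeq] <;> ring

theorem bidiag_apply (a d u : ℕ → K) (ℓ : ℕ) :
    bidiag a d u ℓ = a ℓ * u ℓ + d ℓ * shiftSeq u ℓ := rfl

variable {a d : ℕ → K}

theorem aeval_X_sub_C_mul (x : K) (P : K[X]) (v : ℕ → K) (ℓ : ℕ) :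
    aeval (bidiag a d) ((X - C x) * P) v ℓ = (a ℓ - x) * aeval (bidiag a d) P v ℓ +
      d ℓ * shiftSeq (aeval (bidiag a d) P v) ℓ := by
  simp [Module.End.mul_apply, bidiag_apply]
  ring

theorem aeval_rootPoly_eq_zero (v : ℕ → K) {n ℓ : ℕ} (hℓ : ℓ < n) :
    aeval (bidiag a d) (rootPoly a n) v ℓ = 0 := by
  induction n generalizing ℓ with
  | zero => simp at hℓ
  | succ n ih =>
    have hs : shiftSeq (aeval (bidiag a d) (rootPoly a n) v) ℓ = 0 := by
      rcases ℓ with _ | ℓ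
      · rfl
      · exact ih (by omega)
    rw [rootPoly_succ, aeval_X_sub_C_mul, hs]
    rcases (Nat.lt_succ_iff.mp hℓ).eq_or_lt with rfl | hlt
    · simp
    · simp [ih hlt]

theorem aeval_bidiag_of_eq_zero {u : ℕ → K} {n : ℕ} (hu : ∀ i < n, u i = 0) (P : K[X]) :
    ∀ i ≤ n, aeval (bidiag a d) P u i = P.eval (a n) * u i := by
  induction P using Polynomial.induction_on with
  | C x => intro i _; simp [Module.algebraMap_end_apply]
  | add P Q hP hQ =>
    intro i hi
    simp [hP i hi, hQ i hi, add_mul]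
  | monomial m x ih =>
    intro i hi
    have hX : C x * X ^ (m + 1) = X * (C x * X ^ m) := by ring
    have hs : shiftSeq (aeval (bidiag a d) (C x * X ^ m) u) i = 0 := by
      rcases i with _ | i
      · rfl
      · exact (ih i (by omega)).trans (by simp [hu i (by omega)])
    rw [hX, map_mul, aeval_X, Module.End.mul_apply, bidiag_apply, hs, ih i hi, eval_mul (p := X), eval_X]
    rcases hi.eq_or_lt with rfl | hlt
    · ring
    · simp [hu i hlt]

variable {r : ℕ} {v : ℕ → K}

theorem aeval_rootPoly_ne_zero
    (ha : ∀ i j, i ≤ j → j < r → a j ≠ a (j + 1) → a i ≠ a (j + 1))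
    (hd : ∀ i < r, a i = a (i + 1) → d (i + 1) ≠ 0)
    (hd' : ∀ i < r, a i ≠ a (i + 1) → d (i + 1) = 0) (hv : ∀ i ≤ r, v i ≠ 0) (n : ℕ) :
    (n ≤ r → aeval (bidiag a d) (rootPoly a n) v n ≠ 0) ∧
      ∀ k, n ≤ k → k < r → a k ≠ a (k + 1) →
        aeval (bidiag a d) (rootPoly a n) v (k + 1) ≠ 0 := by
  induction n with
  | zero => exact ⟨fun h => by simpa [rootPoly] using hv 0 h,
      fun k _ hk _ => by simpa [rootPoly] using hv (k + 1) hk⟩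
  | succ n ih =>
    have key (k : ℕ) (hnk : n ≤ k) (hk : k < r) (hak : a k ≠ a (k + 1)) :
        aeval (bidiag a d) (rootPoly a (n + 1)) v (k + 1) ≠ 0 := by
      rw [rootPoly_succ, aeval_X_sub_C_mul, hd' k hk hak, zero_mul, add_zero]
      exact mul_ne_zero (sub_ne_zero.mpr (ha n k hnk hk hak).symm) (ih.2 k hnk hk hak)
    refine ⟨fun hn => ?_, fun k hnk => key k (by omega)⟩
    by_cases han : a n = a (n + 1)
    · rw [rootPoly_succ, aeval_X_sub_C_mul, han, sub_self, zero_mul, zero_add]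
      exact mul_ne_zero (hd n hn han) (ih.1 (by omega))
    · exact key n le_rfl hn han

theorem eq_zero_of_aeval_bidiag
    (hu : ∀ n ≤ r, aeval (bidiag a d) (rootPoly a n) v n ≠ 0)
    {B : K[X]} (hB : B.degree < (r + 1 : ℕ)) (h : ∀ ℓ ≤ r, aeval (bidiag a d) B v ℓ = 0) :
    B = 0 := by
  have hdvd (n : ℕ) (hn : n ≤ r + 1) : rootPoly a n ∣ B := by
    induction n with
    | zero => simp [rootPoly]
    | succ n ih =>
      obtain ⟨Q, rfl⟩ := ih (by omega)
      have hn' : n ≤ r := by omega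
      have := h n hn'
      rw [mul_comm, map_mul, Module.End.mul_apply,
        aeval_bidiag_of_eq_zero (fun i hi => aeval_rootPoly_eq_zero v hi) Q n le_rfl] at this
      obtain ⟨Q', rfl⟩ := dvd_iff_isRoot.mpr ((mul_eq_zero.mp this).resolve_right (hu n hn'))
      exact ⟨Q', by rw [rootPoly_succ]; ring⟩
  exact eq_zero_of_dvd_of_degree_lt (hdvd _ le_rfl) (by rwa [degree_rootPoly])

theorem det_aeval_bidiag_ne_zero (hu : ∀ n ≤ r, aeval (bidiag a d) (rootPoly a n) v n ≠ 0)
    (c : ℕ → K) :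
    (Matrix.of fun ℓ j : Fin (r + 1) => aeval (bidiag a d) (rootPoly c j) v ℓ).det ≠ 0 := by
  intro hdet
  obtain ⟨x, hx, hMx⟩ := Matrix.exists_mulVec_eq_zero_iff.mpr hdet
  refine hx (funext fun j => ?_)
  have hB : ∑ j : Fin (r + 1), x j • rootPoly c j = 0 := by
    refine eq_zero_of_aeval_bidiag hu ?_ fun ℓ hℓ => ?_
    · refine lt_of_le_of_lt (degree_sum_le _ _) ?_
      rw [Finset.sup_lt_iff (WithBot.bot_lt_coe _)]
      intro j _
      refine (degree_smul_le _ _).trans_lt ?_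
      rw [degree_rootPoly]
      exact_mod_cast j.isLt
    · have := congr_fun hMx ⟨ℓ, by omega⟩
      simp only [Matrix.mulVec, dotProduct, Matrix.of_apply, Pi.zero_apply] at this
      simp only [map_sum, map_smul, LinearMap.sum_apply, LinearMap.smul_apply, Finset.sum_apply,
        Pi.smul_apply, smul_eq_mul]
      simpa [mul_comm] using this
  exact Fintype.linearIndependent_iff.mp
    ((linearIndependent_rootPoly c).comp (fun j : Fin (r + 1) => (j : ℕ)) Fin.val_injective) x hB j

end LinearAlgebra

section Dimension

theorem slash_S_apply (k : ℤ) (f : ℍ → ℂ) (z : ℍ) :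
    (f ∣[k] ModularGroup.S) z = f (ModularGroup.S • z) * (z : ℂ) ^ (-k) := by
  rw [ModularForm.SL_slash_apply, ModularGroup.denom_S]

theorem vadd_eq_of_slash_T {k : ℤ} {f : ℍ → ℂ} (hf : f ∣[k] ModularGroup.T = f) (n : ℕ) (z : ℍ) :
    f ((n : ℝ) +ᵥ z) = f z := by
  induction n with
  | zero => simp
  | succ n ih =>
    rw [← ih]
    have hT := congr_fun hf ((n : ℝ) +ᵥ z)
    have hdenom : denom ModularGroup.T ((n : ℝ) +ᵥ z : ℍ) = 1 := by
      rw [ModularGroup.denom_apply]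
      simp [ModularGroup.T]
    rw [ModularForm.SL_slash_apply, modular_T_smul, vadd_vadd, hdenom, one_zpow, mul_one] at hT
    rw [← hT, Nat.cast_succ, add_comm (1 : ℝ)]

theorem eq_zero_of_sum_Eis_two_pow {w : ℤ} {r : ℕ} {h : ℕ → ℍ → ℂ}
    (hh : ∀ ℓ ≤ r, h ℓ ∈ Mset (w - 2 * ℓ))
    (hsum : ∀ z, ∑ ℓ ∈ range (r + 1), Eis 2 z ^ ℓ * h ℓ z = 0) : ∀ ℓ ≤ r, h ℓ = 0 := by
  set κ : ℂ := -(6 * Complex.I / π) with hκ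
  have hκ0 : κ ≠ 0 := by simp [hκ]
  have hS (z : ℍ) : ∑ ℓ ∈ range (r + 1), (Eis 2 z + κ / z) ^ ℓ * h ℓ z = 0 := by
    have hz := z.ne_zero
    have hE : Eis 2 (ModularGroup.S • z) = (Eis 2 z + κ / z) * (z : ℂ) ^ 2 := by
      have := congr_fun Eis_two_slash_S z
      rw [slash_S_apply, Pi.add_apply] at this
      rw [← this, zpow_neg, mul_assoc]
      norm_cast
      rw [inv_mul_cancel₀ (pow_ne_zero 2 hz), mul_one]
    have hf := hsum (ModularGroup.S • z)
    have hterm (ℓ : ℕ) (hℓ : ℓ ∈ range (r + 1)) :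
        Eis 2 (ModularGroup.S • z) ^ ℓ * h ℓ (ModularGroup.S • z) =
          (z : ℂ) ^ w * ((Eis 2 z + κ / z) ^ ℓ * h ℓ z) := by
      have := congr_fun (slash_of_mem_Mset (hh ℓ (by simpa [Nat.lt_succ_iff] using hℓ))
        ModularGroup.S) z
      rw [slash_S_apply] at this
      rw [← this, hE, mul_pow, ← pow_mul]
      have hzw : (z : ℂ) ^ w * (z : ℂ) ^ (-(w - 2 * ℓ)) = (z : ℂ) ^ (2 * ℓ) := by
        rw [← zpow_add₀ hz, ← zpow_natCast]
        congr 1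
        push_cast
        ring
      rw [← hzw]
      ring
    rw [Finset.sum_congr rfl hterm, ← Finset.mul_sum] at hf
    exact (mul_eq_zero.mp hf).resolve_left (zpow_ne_zero _ hz)
  intro ℓ hℓ
  ext z
  let P : Polynomial ℂ := ∑ ℓ ∈ range (r + 1), Polynomial.monomial ℓ (h ℓ z)
  have hP : P = 0 := by
    refine Polynomial.eq_zero_of_infinite_isRoot P ?_
    refine Set.infinite_of_injective_forall_mem
      (f := fun n : ℕ => Eis 2 z + κ / (((n : ℝ) +ᵥ z : ℍ) : ℂ)) (fun m n hmn => ?_) fun n => ?_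
    · have := (add_left_cancel hmn : κ / _ = κ / _)
      simpa [div_eq_mul_inv, hκ0] using this
    · have := hS ((n : ℝ) +ᵥ z)
      simp only [Set.mem_ofPred_eq, Polynomial.IsRoot, P, Polynomial.eval_finsetSum,
        Polynomial.eval_monomial]
      rw [← this]
      refine Finset.sum_congr rfl fun ℓ hℓ => ?_
      rw [vadd_eq_of_slash_T Eis_two_slash_T, vadd_eq_of_slash_T (slash_of_mem_Mset
        (hh ℓ (by simpa [Nat.lt_succ_iff] using hℓ)) ModularGroup.T), mul_comm]
  have := congr_arg (Polynomial.coeff · ℓ) hP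
  simpa [P, Polynomial.coeff_monomial, Nat.lt_succ_iff.mpr hℓ] using this

theorem finrank_modularForm {n : ℕ} (hn : Even n) :
    Module.finrank ℂ (ModularForm 𝒮ℒ (n : ℤ)) =
      if n ≡ 2 [MOD 12] then n / 12 else n / 12 + 1 :=
  Module.finrank_eq_of_rank_eq (ModularForm.dimension_level_one n hn)

theorem sum_finrank_le_dimQM (w : ℤ) (r : ℕ) [Module.Finite ℂ (QM w r)] :
    ∑ ℓ : Fin (r + 1), Module.finrank ℂ (ModularForm 𝒮ℒ (w - 2 * (ℓ : ℕ))) ≤ dimQM w r := by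
  let Φ : (∀ ℓ : Fin (r + 1), ModularForm 𝒮ℒ (w - 2 * (ℓ : ℕ))) →ₗ[ℂ] ℍ → ℂ :=
    { toFun := fun F z => ∑ ℓ : Fin (r + 1), Eis 2 z ^ (ℓ : ℕ) * F ℓ z
      map_add' := fun F G => by
        ext z
        simp [mul_add, Finset.sum_add_distrib]
      map_smul' := fun c F => by
        ext z
        simp [Finset.mul_sum, mul_left_comm] }
  let coeff (F : ∀ ℓ : Fin (r + 1), ModularForm 𝒮ℒ (w - 2 * (ℓ : ℕ))) : ℕ → ℍ → ℂ :=
    fun ℓ => if hℓ : ℓ < r + 1 then F ⟨ℓ, hℓ⟩ else 0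
  have hcoeff (F) (ℓ : ℕ) (hℓ : ℓ ≤ r) : coeff F ℓ ∈ Mset (w - 2 * ℓ) := by
    have : ℓ < r + 1 := by omega
    simp only [coeff, this, dif_pos]
    exact mem_Mset_iff.mpr ⟨F ⟨ℓ, this⟩, rfl⟩
  have hfin (F) (ℓ : Fin (r + 1)) : coeff F ℓ = F ℓ := dif_pos ℓ.isLt
  have hΦ (F) (z : ℍ) : Φ F z = ∑ ℓ ∈ range (r + 1), Eis 2 z ^ ℓ * coeff F ℓ z := by
    rw [Finset.sum_range]
    simp only [hfin]
    rfl
  have hmem (F) : Φ F ∈ QM w r := Submodule.subset_span ⟨coeff F, hcoeff F, hΦ F⟩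
  have hinj : Function.Injective (Φ.codRestrict (QM w r) hmem) := by
    rw [← LinearMap.ker_eq_bot, LinearMap.ker_codRestrict, LinearMap.ker_eq_bot']
    intro F hF
    have h0 := eq_zero_of_sum_Eis_two_pow (hcoeff F) fun z => by rw [← hΦ, hF, Pi.zero_apply]
    funext ℓ
    refine DFunLike.coe_injective ?_
    rw [← hfin, h0 ℓ (Nat.lt_succ_iff.mp ℓ.isLt), Pi.zero_apply, FunLike.coe_zero]
  rw [← Module.finrank_pi_fintype]
  exact LinearMap.finrank_le_finrank_of_injective hinj

theorem le_dimQM {w : ℤ} {r : ℕ} (hr : r ≤ 4) (hw : (12 : ℤ) ∣ (r + 1) * w) (he : Even w)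
    (hw0 : 2 * (r : ℤ) ≤ w) (hdim : 0 < dimQM w r) : (r + 1) * w + 12 ≤ 12 * dimQM w r := by
  have : Module.Finite ℂ (QM w r) := Module.finite_of_finrank_pos hdim
  lift w to ℕ using by omega
  have hsum := sum_finrank_le_dimQM (w : ℤ) r
  have hn (ℓ : Fin (r + 1)) : Module.finrank ℂ (ModularForm 𝒮ℒ ((w : ℤ) - 2 * (ℓ : ℕ))) =
      if w - 2 * (ℓ : ℕ) ≡ 2 [MOD 12] then (w - 2 * ℓ) / 12 else (w - 2 * ℓ) / 12 + 1 := by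
    have hℓ := ℓ.isLt
    have hcast : (w : ℤ) - 2 * (ℓ : ℕ) = ((w - 2 * ℓ : ℕ) : ℤ) := by omega
    rw [hcast]
    refine finrank_modularForm ?_
    have : Even w := by exact_mod_cast he
    exact (Nat.even_sub (by omega)).mpr (by simp [this])
  simp only [hn, Nat.ModEq] at hsum
  obtain ⟨m, hm⟩ := he
  interval_cases r <;> simp [Fin.sum_univ_succ] at hsum <;> push_cast at hw hw0 ⊢ <;>
    split_ifs at hsum <;> omega

end Dimension

section Main

open Polynomial (aeval)

theorem det_attached {r : ℕ} (H : Fin (r + 1) → ℕ → ℍ → ℂ) (z : ℍ) :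
    (Matrix.of fun ℓ j : Fin (r + 1) => attached r (H j) ℓ z).det =
      (Matrix.of fun ℓ j : Fin (r + 1) => H j ℓ).det z := by
  let U : Matrix (Fin (r + 1)) (Fin (r + 1)) ℂ :=
    Matrix.of fun ℓ k => ((k : ℕ).choose ℓ : ℂ) * Eis 2 z ^ ((k : ℕ) - ℓ)
  have hU : U.det = 1 := by
    rw [Matrix.det_of_isUpperTriangular fun ℓ k hkℓ => by
      simp [U, Nat.choose_eq_zero_of_lt (show (k : ℕ) < ℓ from hkℓ)]]
    simp [U]
  have hmul : (Matrix.of fun ℓ j : Fin (r + 1) => attached r (H j) ℓ z) =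
      U * (Matrix.of fun ℓ j : Fin (r + 1) => H j ℓ z) := by
    ext ℓ j
    simp only [Matrix.of_apply, Matrix.mul_apply, attached, Finset.sum_range, U]
  rw [hmul, Matrix.det_mul, hU, one_mul]
  exact ((Pi.evalRingHom (fun _ : ℍ => ℂ) z).map_det _).symm

theorem hasLead_det {r : ℕ} {H : Fin (r + 1) → ℕ → ℍ → ℂ} {lam : ℕ → ℕ}
    {c : Matrix (Fin (r + 1)) (Fin (r + 1)) ℂ}
    (hH : ∀ ℓ j : Fin (r + 1), HasLead (attached r (H j) ℓ) (lam ℓ) (c ℓ j)) :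
    HasLead (Matrix.of fun ℓ j : Fin (r + 1) => H j ℓ).det (∑ ℓ ∈ range (r + 1), lam ℓ) c.det := by
  have := HasLead.det hH
  simp only [det_attached, ← Finset.sum_range lam] at this
  exact this

theorem det_mem_Mset_of_weights {r : ℕ} {H : Fin (r + 1) → ℕ → ℍ → ℂ} {b : Fin (r + 1) → ℤ}
    (hH : ∀ j ℓ : Fin (r + 1), H j ℓ ∈ Mset (b j - 2 * (ℓ : ℕ))) :
    (Matrix.of fun ℓ j : Fin (r + 1) => H j ℓ).det ∈ Mset (∑ j, (b j - 2 * (j : ℕ))) := by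
  have := det_mem_Mset (A := Matrix.of fun ℓ j : Fin (r + 1) => H j ℓ)
    (a := fun ℓ => -(2 * ((ℓ : ℕ) : ℤ))) (b := b) fun ℓ j => by
      rw [neg_add_eq_sub]
      exact hH j ℓ
  rwa [← Finset.sum_add_distrib, Finset.sum_congr rfl fun _ _ => neg_add_eq_sub _ _] at this

/-- The off-diagonal entries of the operator describing the leading coefficients. -/
noncomputable def leadCoupling (r : ℕ) (lam : ℕ → ℕ) (ℓ : ℕ) : ℂ :=
  if lam (ℓ - 1) = lam ℓ then (r - ℓ + 1) / 12 else 0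

/-- The operator describing the leading coefficients of the normalized derivative. -/
noncomputable def leadOp (r : ℕ) (lam : ℕ → ℕ) : Module.End ℂ (ℕ → ℂ) :=
  bidiag (fun ℓ => (lam ℓ : ℂ)) (leadCoupling r lam)

/-- The number `(w - r + 2 i) / 12` entering the `i`-th iterated Serre derivative. -/
def serreRoot (w : ℤ) (r i : ℕ) : ℚ := (w - r + 2 * i) / 12

variable {w : ℤ} {r : ℕ} {h : ℕ → ℍ → ℂ} {lam : ℕ → ℕ} {v : ℕ → ℂ}

theorem hasLead_attached_coeffIter (hr : r ≤ 4) (hh : ∀ ℓ : ℕ, h ℓ ∈ Mset (w - 2 * ℓ))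
    (h0 : ∀ ℓ, r < ℓ → h ℓ = 0) (hlam : ∀ i j, i ≤ j → j ≤ r → lam j ≤ lam i)
    (hv : ∀ ℓ ≤ r, HasLead (attached r h ℓ) (lam ℓ) (v ℓ)) (j : ℕ) {ℓ : ℕ} (hℓ : ℓ ≤ r) :
    HasLead (attached r (coeffIter w r h j) ℓ) (lam ℓ)
      (aeval (leadOp r lam) (rootPoly (fun i => (serreRoot w r i : ℂ)) j) v ℓ) := by
  induction j generalizing ℓ with
  | zero => simpa [coeffIter, rootPoly] using hv ℓ hℓ
  | succ j ih =>
    rw [rootPoly_succ, leadOp, aeval_X_sub_C_mul, ← leadOp,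
      funext (attached_coeffIter_succ hr hh h0 j hℓ)]
    refine HasLead.add ?_ ?_
    · convert (ih hℓ).serre (w - r + 2 * j) using 3
      simp [serreRoot]
    · rcases ℓ with _ | ℓ
      · simpa [shiftSeq] using (ih hℓ).const_mul 0
      · have hlast := ih (ℓ := ℓ) (by omega)
        simp only [shiftSeq, leadCoupling, Nat.add_sub_cancel]
        split_ifs with heq
        · rw [← heq]
          exact hlast.const_mul _
        · rw [zero_mul, ← mul_zero]
          exact (hlast.of_lt ((hlam ℓ (ℓ + 1) ℓ.le_succ hℓ).lt_of_ne' heq)).const_mul _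

theorem det_lead_ne_zero (hlam : ∀ i j, i ≤ j → j ≤ r → lam j ≤ lam i) (hv : ∀ ℓ ≤ r, v ℓ ≠ 0)
    (c : ℕ → ℂ) :
    (Matrix.of fun ℓ j : Fin (r + 1) => aeval (leadOp r lam) (rootPoly c j) v ℓ).det ≠ 0 := by
  refine det_aeval_bidiag_ne_zero (fun n hn => (aeval_rootPoly_ne_zero (r := r)
    (fun i j hij hj hne => ?_) (fun i hi heq => ?_) (fun i hi hne => ?_) hv n).1 hn) c
  · have h1 := hlam i j hij hj.le
    have h2 := hlam j (j + 1) j.le_succ hj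
    norm_cast at hne ⊢
    omega
  · have heq' : lam i = lam (i + 1) := by exact_mod_cast heq
    rw [leadCoupling, Nat.add_sub_cancel, if_pos heq']
    have : ((r - i : ℕ) : ℂ) ≠ 0 := Nat.cast_ne_zero.mpr (by omega)
    rw [Nat.cast_sub hi.le] at this
    simpa [← sub_sub] using this
  · have hne' : lam i ≠ lam (i + 1) := by exact_mod_cast hne
    rw [leadCoupling, Nat.add_sub_cancel, if_neg hne']

/-- The determinant of the coefficients of the iterated Serre derivatives; up to a constant, the
modular Wronskian. -/
noncomputable def coeffDet (w : ℤ) (r : ℕ) (h : ℕ → ℍ → ℂ) : ℍ → ℂ :=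
  (Matrix.of fun ℓ j : Fin (r + 1) => coeffIter w r h j ℓ).det

theorem coeffDet_mem_Mset (hh : ∀ ℓ : ℕ, h ℓ ∈ Mset (w - 2 * ℓ)) :
    coeffDet w r h ∈ Mset ((r + 1) * w) := by
  have := det_mem_Mset_of_weights (H := fun j : Fin (r + 1) => coeffIter w r h j)
    (b := fun j => w + 2 * (j : ℕ)) fun j ℓ => coeffIter_mem_Mset hh j ℓ
  simpa [coeffDet] using this

theorem twelve_mul_sum_le {c : ℂ} (hw : 0 ≤ w) (hh : ∀ ℓ : ℕ, h ℓ ∈ Mset (w - 2 * ℓ))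
    (hc : c ≠ 0) {n : ℕ} (hW : HasLead (coeffDet w r h) n c) : 12 * (n : ℤ) ≤ (r + 1) * w := by
  by_contra! hlt
  have hn : 0 < n := by
    rcases n.eq_zero_or_pos with rfl | hn
    · have : 0 ≤ ((r : ℤ) + 1) * w := by positivity
      simp at hlt
      omega
    · exact hn
  have hzero := hW.eq_zero_of_mem_Mset (coeffDet_mem_Mset hh) hn hlt
  have := hW.eq_zero_of_mul_eq_zero hc (HasLead.const 1) fun z => by simp [hzero]
  simpa using congr_fun this UpperHalfPlane.I

theorem coeff_eq_zero_of_lead_eq_zero (hr : r ≤ 4) (hh : ∀ ℓ : ℕ, h ℓ ∈ Mset (w - 2 * ℓ))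
    {c : Matrix (Fin (r + 1)) (Fin (r + 1)) ℂ} (hc : c.det ≠ 0)
    (hlead : ∀ ℓ j : Fin (r + 1), HasLead (attached r (coeffIter w r h j) ℓ) (lam ℓ) (c ℓ j))
    (hsum : 12 * ((∑ ℓ ∈ range (r + 1), lam ℓ : ℕ) : ℤ) = (r + 1) * w) {u : ℕ → ℍ → ℂ}
    (hu : ∀ ℓ : ℕ, u ℓ ∈ Mset (w + 2 * (r + 1) - 2 * ℓ))
    (hul : ∀ ℓ ≤ r, HasLead (attached r u ℓ) (lam ℓ) 0) (ℓ : Fin (r + 1)) : u ℓ = 0 := by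
  let A : Matrix (Fin (r + 1)) (Fin (r + 1)) (ℍ → ℂ) :=
    Matrix.of fun ℓ j => coeffIter w r h j ℓ
  have hcramer : A.cramer (fun ℓ => u ℓ) = 0 := by
    ext1 i
    let H : Fin (r + 1) → ℕ → ℍ → ℂ := Function.update (fun j => coeffIter w r h j) i u
    have hA : A.updateCol i (fun ℓ => u ℓ) = Matrix.of fun ℓ j : Fin (r + 1) => H j ℓ := by
      ext1 ℓ j
      rcases eq_or_ne j i with rfl | hji
      · simp [H]
      · simp [H, A, hji]
    have hH : (Matrix.of fun ℓ j : Fin (r + 1) => H j ℓ).det ∈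
        Mset ((r + 1) * w + 2 * (r + 1 - (i : ℕ))) := by
      have := det_mem_Mset_of_weights (H := H)
        (b := fun j => if j = i then w + 2 * (r + 1) else w + 2 * (j : ℕ)) fun j ℓ => by
          rcases eq_or_ne j i with rfl | hji
          · simpa [H] using hu ℓ
          · simpa [H, hji] using coeffIter_mem_Mset hh j ℓ
      have hweight (j : Fin (r + 1)) :
          (if j = i then w + 2 * (r + 1) else w + 2 * (j : ℕ)) - 2 * ((j : ℕ) : ℤ) =
            w + if j = i then 2 * ((r : ℤ) + 1 - (i : ℕ)) else 0 := by
        split_ifs with hji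
        · rw [hji]
          ring
        · ring
      simpa [hweight, Finset.sum_add_distrib] using this
    have hlead' : HasLead (Matrix.of fun ℓ j : Fin (r + 1) => H j ℓ).det
        (∑ ℓ ∈ range (r + 1), lam ℓ) (c.updateCol i 0).det := by
      refine hasLead_det fun ℓ j => ?_
      rcases eq_or_ne j i with rfl | hji
      · simpa [H] using hul ℓ (Nat.lt_succ_iff.mp ℓ.isLt)
      · simpa [H, hji] using hlead ℓ j
    rw [Matrix.det_eq_zero_of_column_eq_zero (A := c.updateCol i 0) i fun ℓ => by simp] at hlead'
    obtain ⟨c', hc'⟩ := hlead'.succ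
    rw [Matrix.cramer_apply, hA]
    refine hc'.eq_zero_of_mem_Mset hH (Nat.succ_pos _) ?_
    push_cast at hsum ⊢
    linarith [show (r : ℤ) ≤ 4 by exact_mod_cast hr, Int.natCast_nonneg (i : ℕ)]
  have hmul := Matrix.mulVec_cramer A (fun ℓ => u ℓ)
  rw [hcramer, Matrix.mulVec_zero] at hmul
  obtain ⟨c', hc'⟩ := HasLead.of_mem_Mset (hu ℓ)
  exact (hasLead_det hlead).eq_zero_of_mul_eq_zero hc hc' fun z =>
    (congr_fun (congr_fun hmul ℓ) z).symm

/-- The coefficients of the modular differential operator applied to `∑ E₂ ^ ℓ * h ℓ`. -/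
noncomputable def coeffMDE (w : ℤ) (r : ℕ) (h : ℕ → ℍ → ℂ) (a : ℕ → ℚ) (ℓ : ℕ) : ℍ → ℂ :=
  coeffIter w r h (r + 1) ℓ +
    ∑ j ∈ Icc 2 (r + 1), (a j : ℂ) • (Eis (2 * j) * coeffIter w r h (r + 1 - j) ℓ)

theorem coeffMDE_mem_Mset (hh : ∀ ℓ : ℕ, h ℓ ∈ Mset (w - 2 * ℓ)) (a : ℕ → ℚ) (ℓ : ℕ) :
    coeffMDE w r h a ℓ ∈ Mset (w + 2 * (r + 1) - 2 * ℓ) := by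
  refine add_mem_Mset ?_ (sum_mem_Mset fun j hj => smul_mem_Mset _ ?_)
  · exact_mod_cast coeffIter_mem_Mset hh (r + 1) ℓ
  · obtain ⟨hj2, hjr⟩ := Finset.mem_Icc.mp hj
    rw [show w + 2 * (r + 1) - 2 * (ℓ : ℤ) =
      ((2 * j : ℕ) : ℤ) + (w + 2 * ((r + 1 - j : ℕ) : ℤ) - 2 * ℓ) by push_cast [hjr]; ring]
    exact mul_mem_Mset (Eis_mem_Mset (by omega) (even_two_mul j)) (coeffIter_mem_Mset hh _ ℓ)

theorem attached_coeffMDE (a : ℕ → ℚ) (ℓ : ℕ) (z : ℍ) :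
    attached r (coeffMDE w r h a) ℓ z = attached r (coeffIter w r h (r + 1)) ℓ z +
      ∑ j ∈ Icc 2 (r + 1), (a j : ℂ) * Eis (2 * j) z *
        attached r (coeffIter w r h (r + 1 - j)) ℓ z := by
  simp only [attached, coeffMDE, Pi.add_apply, Finset.sum_apply, Pi.smul_apply, Pi.mul_apply,
    smul_eq_mul, mul_add, Finset.sum_add_distrib, Finset.mul_sum]
  rw [Finset.sum_comm]
  congr 1
  exact Finset.sum_congr rfl fun j _ => Finset.sum_congr rfl fun k _ => by ring

theorem sum_Icc_two_reflect {M : Type*} [AddCommMonoid M] (f : ℕ → M) (r : ℕ) :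
    ∑ j ∈ Icc 2 (r + 1), f (r + 1 - j) = ∑ j ∈ range r, f j := by
  refine Finset.sum_nbij' (fun j => r + 1 - j) (fun j => r + 1 - j) ?_ ?_ ?_ ?_ fun _ _ => rfl <;>
    simp only [Finset.mem_Icc, Finset.mem_range] <;> intro j hj <;> omega

theorem sum_serreRoot (w : ℤ) (r : ℕ) :
    ∑ i ∈ range (r + 1), serreRoot w r i = (r + 1) * w / 12 := by
  induction r with
  | zero => simp [serreRoot]
  | succ r ih =>
    have hsucc (i : ℕ) : serreRoot w (r + 1) i = serreRoot w r i - 1 / 12 := by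
      simp only [serreRoot]
      push_cast
      ring
    rw [Finset.sum_range_succ, Finset.sum_congr rfl fun i _ => hsucc i, Finset.sum_sub_distrib, ih]
    simp [serreRoot]
    ring

theorem exists_lead_coeffMDE_eq_zero (hr : r ≤ 4) (hh : ∀ ℓ : ℕ, h ℓ ∈ Mset (w - 2 * ℓ))
    (h0 : ∀ ℓ, r < ℓ → h ℓ = 0) (hlam : ∀ i j, i ≤ j → j ≤ r → lam j ≤ lam i)
    (hv : ∀ ℓ ≤ r, HasLead (attached r h ℓ) (lam ℓ) (v ℓ))
    (hsum : 12 * ((∑ ℓ ∈ range (r + 1), lam ℓ : ℕ) : ℤ) = (r + 1) * w) :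
    ∃ a : ℕ → ℚ, ∀ ℓ ≤ r, HasLead (attached r (coeffMDE w r h a) ℓ) (lam ℓ) 0 := by
  have hroots : ∑ i ∈ range (r + 1), (lam i : ℚ) = ∑ i ∈ range (r + 1), serreRoot w r i := by
    rw [sum_serreRoot, eq_div_iff (by norm_num), mul_comm]
    exact_mod_cast hsum
  obtain ⟨b, hb⟩ := rootPoly_eq_add_sum hroots
  have hb' : rootPoly (fun i => (lam i : ℂ)) (r + 1) =
      rootPoly (fun i => (serreRoot w r i : ℂ)) (r + 1) +
        ∑ j ∈ range r, (b j : ℂ) • rootPoly (fun i => (serreRoot w r i : ℂ)) j := by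
    have := congr_arg (Polynomial.map (algebraMap ℚ ℂ)) hb
    simpa [rootPoly, Polynomial.map_prod, Polynomial.map_sum,
      Polynomial.smul_eq_C_mul] using this
  refine ⟨fun j => b (r + 1 - j), fun ℓ hℓ => ?_⟩
  have hzero := aeval_rootPoly_eq_zero (a := fun i => (lam i : ℂ)) (d := leadCoupling r lam) v
    (Nat.lt_succ_iff.mpr hℓ)
  rw [hb', ← leadOp, ← sum_Icc_two_reflect
    fun j => (b j : ℂ) • rootPoly (fun i => (serreRoot w r i : ℂ)) j] at hzero
  rw [← hzero, funext (attached_coeffMDE _ ℓ)]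
  simp only [map_add, map_sum, map_smul, LinearMap.add_apply, LinearMap.sum_apply,
    LinearMap.smul_apply, Pi.add_apply, Finset.sum_apply, Pi.smul_apply, smul_eq_mul]
  have hlead (j : ℕ) := hasLead_attached_coeffIter hr hh h0 hlam hv j hℓ
  refine (hlead _).add (HasLead.sum fun j hj => ?_)
  have hE := (hasLead_Eis (k := 2 * j) (by have := (Finset.mem_Icc.mp hj).1; omega)).const_mul
    (b (r + 1 - j) : ℂ)
  simpa using hE.mul (hlead (r + 1 - j))

theorem exists_hasLead_attached {ℓ : ℕ} (hℓ : ℓ ≤ r) {n : ℕ}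
    (hg : HasQExpansionAt (gOf r h ℓ) n) : ∃ c, c ≠ 0 ∧ HasLead (attached r h ℓ) n c := by
  obtain ⟨a, ha, hsum⟩ := hg
  set κ : ℂ := (r.choose ℓ : ℂ)⁻¹ * (6 / (π * Complex.I)) ^ ℓ with hκ
  have hκ0 : κ ≠ 0 := by
    have : (r.choose ℓ : ℂ) ≠ 0 := Nat.cast_ne_zero.mpr (Nat.choose_pos hℓ).ne'
    simp [hκ, this]
  refine ⟨κ⁻¹ * a 0, mul_ne_zero (inv_ne_zero hκ0) ha, ?_⟩
  have hlead := (HasLead.of_hasSum hsum).const_mul κ⁻¹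
  simpa only [gOf_eq hℓ, ← hκ, inv_mul_cancel_left₀ hκ0] using hlead

theorem exists_mde (hr : r ≤ 4) (hw : (12 : ℤ) ∣ (r + 1) * w)
    (hh : ∀ ℓ : ℕ, h ℓ ∈ Mset (w - 2 * ℓ)) (h0 : ∀ ℓ, r < ℓ → h ℓ = 0) (hhr : h r ≠ 0)
    (hlam : ∀ i j, i ≤ j → j ≤ r → lam j ≤ lam i)
    (hg : ∀ ℓ ≤ r, HasQExpansionAt (gOf r h ℓ) (lam ℓ)) (hdim : 0 < dimQM w r)
    (hsum : ∑ ℓ ∈ range (r + 1), lam ℓ = dimQM w r - 1) :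
    ∃ a : ℕ → ℚ, ∀ z : ℍ, serreIter (w - r) (r + 1) (attached r h 0) z +
      ∑ j ∈ Icc 2 (r + 1),
        (a j : ℂ) * Eis (2 * j) z * serreIter (w - r) (r + 1 - j) (attached r h 0) z = 0 := by
  obtain ⟨heven, hnonneg⟩ := weight_of_mem_Mset (hh r) hhr
  have heven : Even w := by simpa [Int.even_sub] using heven
  choose! v hv0 hv using fun ℓ (hℓ : ℓ ≤ r) => exists_hasLead_attached hℓ (hg ℓ hℓ)
  have hlead (ℓ j : Fin (r + 1)) :=
    hasLead_attached_coeffIter hr hh h0 hlam hv j (Nat.lt_succ_iff.mp ℓ.isLt)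
  have hdet := det_lead_ne_zero hlam hv0 fun i => (serreRoot w r i : ℂ)
  have hle := twelve_mul_sum_le (by omega) hh hdet (hasLead_det hlead)
  have hge := le_dimQM hr hw heven (by omega) hdim
  have hsum' : 12 * ((∑ ℓ ∈ range (r + 1), lam ℓ : ℕ) : ℤ) = (r + 1) * w := by
    rw [hsum] at hle ⊢
    omega
  obtain ⟨a, ha⟩ := exists_lead_coeffMDE_eq_zero hr hh h0 hlam hv hsum'
  refine ⟨a, fun z => ?_⟩
  have hzero := coeff_eq_zero_of_lead_eq_zero hr hh hdet hlead hsum' (coeffMDE_mem_Mset hh a) ha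
  simp only [← attached_coeffIter_zero hr hh h0, ← attached_coeffMDE]
  refine Finset.sum_eq_zero fun k hk => ?_
  rw [show coeffMDE w r h a k = 0 from hzero ⟨k, Finset.mem_range.mp hk⟩, Pi.zero_apply, mul_zero]

end Main

end QuasiModular

/-- Theorem 1 of the paper: every balanced quasimodular form of depth
`r ≤ 4` and weight `w` with `(r+1)w ≡ 0 (mod 12)` solves a modular differential equation
`∂_{w-r}^{r+1} f + a_4 E_4 ∂_{w-r}^{r-1} f + … + a_{2r+2} E_{2r+2} f = 0` with rational
coefficients. -/
theorem balanced_satisfies_mde (w : ℤ) (r : ℕ) (hr : r ≤ 4)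
    (hw : (12 : ℤ) ∣ (r + 1) * w) (f : ℍ → ℂ) (hf : IsBalancedQM w r f) :
    ∃ a : ℕ → ℚ, ∀ z : ℍ,
      serreIter (w - r) (r + 1) f z +
        ∑ j ∈ Finset.Icc 2 (r + 1),
          (a j : ℂ) * Eis (2 * j) z * serreIter (w - r) (r + 1 - j) f z = 0 := by
  obtain ⟨h, lam, hh, hhr, hf, hg, hlam, hdim, hsum⟩ := hf
  let h' : ℕ → ℍ → ℂ := fun ℓ => if ℓ ≤ r then h ℓ else 0
  have hh' (ℓ : ℕ) (hℓ : ℓ ≤ r) : h' ℓ = h ℓ := if_pos hℓ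
  have hgOf (ℓ : ℕ) (hℓ : ℓ ≤ r) : gOf r h' ℓ = gOf r h ℓ := by
    ext z
    simp only [gOf]
    congr 1
    refine Finset.sum_congr rfl fun m hm => ?_
    rw [hh' _ (by have := Finset.mem_range.mp hm; omega)]
  have hf' : f = QuasiModular.attached r h' 0 := by
    ext z
    rw [hf, QuasiModular.attached]
    refine Finset.sum_congr rfl fun k hk => ?_
    rw [hh' _ (Nat.lt_succ_iff.mp (Finset.mem_range.mp hk))]
    simp
  rw [hf']
  refine QuasiModular.exists_mde (lam := lam) hr hw (fun ℓ => ?_) (fun ℓ hℓ => if_neg (by omega))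
    (by rwa [hh' r le_rfl]) hlam (fun ℓ hℓ => by rw [hgOf ℓ hℓ]; exact hg ℓ hℓ) ?_ hsum
  · by_cases hℓ : ℓ ≤ r
    · rw [hh' ℓ hℓ]
      exact hh ℓ hℓ
    · rw [show h' ℓ = 0 from if_neg hℓ]
      exact QuasiModular.zero_mem_Mset _
  · simpa using (Nat.zero_le _).trans_lt (hdim 0 (Nat.zero_le r))
end

section
/- Let w ≡ a (mod 6) with a ∈ {0,2,4}, let (w−a)/12 ≤ λ ≤ (w−a)/6 be an integer, and let f(z) = q^λ ∑_{n≥0} a(n)q^n be a holomorphic solution with a(0) ≠ 0. (a = 0): If f solves ∂_{w−1}^2 f − ((12λ−w−1)(12λ−w+1)/144) E_4 f = 0, then f is a balanced quasimodular form of weight w and depth 1 provided λ > w/12; if λ = w/12, then Δ^{w/12} and zΔ^{w/12} form a fundamental system. (a = 2): If f solves E_4 ∂_{w−1}^2 f + (1/3)E_6 ∂_{w−1} f − ((12λ−w+1)(12λ−w+3)/144) E_4^2 f = 0, then f is balanced of weight w and depth 1 provided λ > (w−2)/12; if λ = (w−2)/12, then E_2 Δ^{(w−2)/12} and z E_2 Δ^{(w−2)/12}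 + (6/(πi)) Δ^{(w−2)/12} form a fundamental system. (a = 4): If f solves E_4^2 ∂_{w−1}^2 f + (2/3)E_4 E_6 ∂_{w−1} f − (((12λ−w+3)(12λ−w+5)/144 − 1/18) E_4^3 + 384Δ) f = 0, then f is balanced of weight w and depth 1 provided λ > (w−4)/12; if λ = (w−4)/12, then E_4 Δ^{(w−4)/12} and z E_4 Δ^{(w−4)/12} form a fundamental system. -/
open Complex UpperHalfPlane Finset
open scoped Manifold MatrixGroups Real

/-! ### Leading terms of `q`-expansions -/

/-- `g = q^N (c + O(q))`: the function `g` has a `q`-expansion starting at `q^N`, whose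
coefficient of `q^N` is `c` (possibly zero). -/
def HasLeadingTerm (g : ℍ → ℂ) (N : ℕ) (c : ℂ) : Prop :=
  ∃ a : ℕ → ℂ, a 0 = c ∧ ∀ z : ℍ, HasSum (fun n : ℕ => a n * qexp z ^ (N + n)) (g z)

lemma qexp_eq_qParam (z : ℍ) : qexp z = Function.Periodic.qParam 1 z := by
  simp [qexp, Function.Periodic.qParam]

lemma qexp_ne_zero (z : ℍ) : qexp z ≠ 0 := Complex.exp_ne_zero _

lemma norm_qexp_lt_one (z : ℍ) : ‖qexp z‖ < 1 := UpperHalfPlane.norm_exp_two_pi_I_lt_one z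

lemma qexp_mem_ball (z : ℍ) : qexp z ∈ Metric.ball (0 : ℂ) 1 := by
  simpa using norm_qexp_lt_one z

lemma exists_qexp_eq {q : ℂ} (hq : q ≠ 0) (h1 : ‖q‖ < 1) : ∃ z : ℍ, qexp z = q :=
  ⟨⟨Function.Periodic.invQParam 1 q,
    Function.Periodic.im_invQParam_pos_of_norm_lt_one one_pos h1 hq⟩, by
    rw [qexp_eq_qParam]; exact Function.Periodic.qParam_right_inv one_ne_zero hq⟩

lemma tendsto_qexp : Filter.Tendsto qexp atImInfty (nhds 0) := by
  have := qParam_tendsto_atImInfty one_pos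
  simpa [funext qexp_eq_qParam] using this

lemma hasLeadingTerm_iff {g : ℍ → ℂ} {N : ℕ} {c : ℂ} :
    HasLeadingTerm g N c ↔ ∃ Φ : ℂ → ℂ, DifferentiableOn ℂ Φ (Metric.ball 0 1) ∧ Φ 0 = c ∧
      ∀ z, g z = qexp z ^ N * Φ (qexp z) := by
  constructor
  · rintro ⟨a, ha0, ha⟩
    have hsum : ∀ q : ℂ, ‖q‖ < 1 → Summable fun n => a n * q ^ n := by
      intro q hq
      rcases eq_or_ne q 0 with rfl | hq0
      · exact summable_of_ne_finset_zero (s := {0}) fun n hn => by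
          simp [zero_pow (by simpa using hn : n ≠ 0)]
      · obtain ⟨z, rfl⟩ := exists_qexp_eq hq0 hq
        have := (ha z).summable.mul_left ((qexp z ^ N)⁻¹)
        refine this.congr fun n => ?_
        have := pow_ne_zero N hq0
        rw [pow_add]
        field_simp
    have hps : HasFPowerSeriesOnBall (fun q => ∑' n, a n * q ^ n)
        (FormalMultilinearSeries.ofScalars ℂ a) 0 1 := by
      refine ⟨le_of_forall_lt_imp_le_of_dense fun r hr => ?_, by simp, fun {y} hy => ?_⟩
      · lift r to NNReal using hr.ne_top
        apply FormalMultilinearSeries.le_radius_of_summable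
        have h := (hsum ((r : ℝ) : ℂ) (by simpa using hr)).norm
        simpa [norm_mul, mul_comm] using h
      · rw [← ENNReal.coe_one, Metric.eball_coe, NNReal.coe_one, mem_ball_zero_iff] at hy
        simpa [mul_comm] using (hsum y hy).hasSum
    refine ⟨fun q => ∑' n, a n * q ^ n, ?_, ?_, fun z => ?_⟩
    · have h := hps.differentiableOn
      rwa [← ENNReal.coe_one, Metric.eball_coe, NNReal.coe_one] at h
    · change ∑' n, a n * (0 : ℂ) ^ n = c
      rw [tsum_eq_single 0 fun n hn => by simp [zero_pow hn]]
      simpa using ha0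
    · rw [← tsum_mul_left, ← (ha z).tsum_eq]
      exact tsum_congr fun n => by rw [pow_add]; ring
  · rintro ⟨Φ, hΦ, h0, hg⟩
    refine ⟨fun n => (n.factorial : ℂ)⁻¹ * iteratedDeriv n Φ 0, by simp [h0], fun z => ?_⟩
    have h := (Complex.hasSum_taylorSeries_on_ball (r := 1) (c := 0) (f := Φ)
      (by simpa using hΦ) (z := qexp z) (by simpa using norm_qexp_lt_one z)).mul_left (qexp z ^ N)
    rw [hg z]
    refine h.congr_fun fun n => ?_
    simp only [sub_zero, smul_eq_mul, pow_add]
    ring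

lemma HasLeadingTerm.hasQExpansionAt {g : ℍ → ℂ} {N : ℕ} {c : ℂ} (h : HasLeadingTerm g N c)
    (hc : c ≠ 0) : HasQExpansionAt g N := by
  obtain ⟨a, rfl, ha⟩ := h
  exact ⟨a, hc, ha⟩

lemma HasLeadingTerm.add {g g' : ℍ → ℂ} {N : ℕ} {c c' : ℂ} (h : HasLeadingTerm g N c)
    (h' : HasLeadingTerm g' N c') : HasLeadingTerm (g + g') N (c + c') := by
  obtain ⟨a, rfl, ha⟩ := h
  obtain ⟨b, rfl, hb⟩ := h'
  exact ⟨a + b, rfl, fun z => by simpa [add_mul] using (ha z).add (hb z)⟩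

lemma HasLeadingTerm.smul {g : ℍ → ℂ} {N : ℕ} {c : ℂ} (h : HasLeadingTerm g N c) (s : ℂ) :
    HasLeadingTerm (s • g) N (s * c) := by
  obtain ⟨a, rfl, ha⟩ := h
  exact ⟨fun n => s * a n, rfl, fun z => by simpa [mul_assoc] using (ha z).mul_left s⟩

lemma HasLeadingTerm.sub {g g' : ℍ → ℂ} {N : ℕ} {c c' : ℂ} (h : HasLeadingTerm g N c)
    (h' : HasLeadingTerm g' N c') : HasLeadingTerm (g - g') N (c - c') := by
  convert h.add (h'.smul (-1)) using 1
  · simp [sub_eq_add_neg]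
  · ring

lemma HasLeadingTerm.mul {g g' : ℍ → ℂ} {N M : ℕ} {c c' : ℂ} (h : HasLeadingTerm g N c)
    (h' : HasLeadingTerm g' M c') : HasLeadingTerm (g * g') (N + M) (c * c') := by
  rw [hasLeadingTerm_iff] at h h' ⊢
  obtain ⟨Φ, hΦ, rfl, hg⟩ := h
  obtain ⟨Ψ, hΨ, rfl, hg'⟩ := h'
  exact ⟨Φ * Ψ, hΦ.mul hΨ, rfl, fun z => by simp only [Pi.mul_apply, hg, hg', pow_add]; ring⟩

lemma hasLeadingTerm_one : HasLeadingTerm 1 0 1 :=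
  hasLeadingTerm_iff.mpr ⟨1, differentiableOn_const 1, rfl, fun z => by simp⟩

lemma HasLeadingTerm.pow {g : ℍ → ℂ} {N : ℕ} {c : ℂ} (h : HasLeadingTerm g N c) (k : ℕ) :
    HasLeadingTerm (g ^ k) (k * N) (c ^ k) := by
  induction k with
  | zero => simpa using hasLeadingTerm_one
  | succ k ih => simpa [pow_succ, add_mul] using ih.mul h

lemma HasLeadingTerm.tendsto {g : ℍ → ℂ} {c : ℂ} (h : HasLeadingTerm g 0 c) :
    Filter.Tendsto g atImInfty (nhds c) := by
  rw [hasLeadingTerm_iff] at h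
  obtain ⟨Φ, hΦ, rfl, hg⟩ := h
  have hcont : ContinuousAt Φ 0 :=
    (hΦ.differentiableAt (Metric.ball_mem_nhds 0 one_pos)).continuousAt
  simpa [funext hg, Function.comp_def] using hcont.tendsto.comp tendsto_qexp

lemma HasLeadingTerm.unique {g : ℍ → ℂ} {N : ℕ} {c c' : ℂ} (h : HasLeadingTerm g N c)
    (h' : HasLeadingTerm g N c') : c = c' := by
  have key : ∀ {d}, HasLeadingTerm g N d → HasLeadingTerm (fun z => g z / qexp z ^ N) 0 d := by
    intro d hd
    rw [hasLeadingTerm_iff] at hd ⊢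
    obtain ⟨Φ, hΦ, h0, hg⟩ := hd
    refine ⟨Φ, hΦ, h0, fun z => ?_⟩
    have := qexp_ne_zero z
    rw [hg]
    field_simp
  exact tendsto_nhds_unique (key h).tendsto (key h').tendsto

lemma HasLeadingTerm.eq_zero {N : ℕ} {c : ℂ} (h : HasLeadingTerm 0 N c) : c = 0 :=
  h.unique ⟨0, rfl, fun z => by simp⟩

lemma HasLeadingTerm.exists_lt_of_ne_zero {g : ℍ → ℂ} {N : ℕ} (h : HasLeadingTerm g N 0)
    (hg : g ≠ 0) : ∃ M > N, ∃ c ≠ 0, HasLeadingTerm g M c := by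
  classical
  obtain ⟨a, ha0, ha⟩ := h
  have hex : ∃ n, a n ≠ 0 := by
    by_contra! hall
    refine hg (funext fun z => (ha z).unique ?_)
    simp [hall]
  have hpos : 0 < Nat.find hex := by
    rw [Nat.find_pos]
    simpa using ha0
  refine ⟨N + Nat.find hex, by omega, a (Nat.find hex), Nat.find_spec hex,
    fun n => a (n + Nat.find hex), by simp, fun z => ?_⟩
  have h := (hasSum_nat_add_iff' (Nat.find hex)).mpr (ha z)
  rw [Finset.sum_eq_zero, sub_zero] at h
  · refine h.congr_fun fun n => ?_
    rw [show N + Nat.find hex + n = N + (n + Nat.find hex) by ring]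
  · intro i hi
    have : a i = 0 := by simpa using Nat.find_min hex (Finset.mem_range.mp hi)
    simp [this]

/-! ### Serre derivatives -/

lemma qderiv_eq (f : ℍ → ℂ) : qderiv f = Derivative.normalizedDerivOfComplex f := by
  ext z
  simp only [qderiv, hderiv, Derivative.normalizedDerivOfComplex]
  congr 1
  refine Filter.EventuallyEq.deriv_eq ?_
  filter_upwards [isOpen_upperHalfPlaneSet.mem_nhds z.im_pos] with w hw
  have hw' : 0 < w.im := hw
  simp [hw', ofComplex_apply_of_im_pos hw']

lemma hasDerivAt_comp_ofComplex {g : ℍ → ℂ} {Φ : ℂ → ℂ}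
    (hΦ : DifferentiableOn ℂ Φ (Metric.ball 0 1)) (hg : ∀ z, g z = Φ (qexp z)) (z : ℍ) :
    HasDerivAt (g ∘ ofComplex) (deriv Φ (qexp z) * (qexp z * (2 * π * Complex.I))) z := by
  have h1 : HasDerivAt (fun w : ℂ => Complex.exp (2 * π * Complex.I * w))
      (qexp z * (2 * π * Complex.I)) z := by
    simpa [qexp] using ((hasDerivAt_id (z : ℂ)).const_mul (2 * π * Complex.I)).cexp
  have h2 : HasDerivAt Φ (deriv Φ (qexp z)) (qexp z) :=
    (hΦ.differentiableAt (Metric.isOpen_ball.mem_nhds (qexp_mem_ball z))).hasDerivAt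
  refine (HasDerivAt.comp (z : ℂ) h2 h1).congr_of_eventuallyEq ?_
  filter_upwards [isOpen_upperHalfPlaneSet.mem_nhds z.im_pos] with w hw
  have hw' : 0 < w.im := hw
  simp [hg, qexp, ofComplex_apply_of_im_pos hw']

lemma HasLeadingTerm.mdifferentiable {g : ℍ → ℂ} {N : ℕ} {c : ℂ} (h : HasLeadingTerm g N c) :
    MDifferentiable 𝓘(ℂ) 𝓘(ℂ) g := by
  rw [hasLeadingTerm_iff] at h
  obtain ⟨Φ, hΦ, -, hg⟩ := h
  exact fun z => mdifferentiableAt_iff.mpr (hasDerivAt_comp_ofComplex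
    (Φ := fun q => q ^ N * Φ q) ((differentiableOn_id.pow N).mul hΦ) hg z).differentiableAt

lemma HasLeadingTerm.qderiv {g : ℍ → ℂ} {N : ℕ} {c : ℂ} (h : HasLeadingTerm g N c) :
    HasLeadingTerm (qderiv g) N (N * c) := by
  rw [hasLeadingTerm_iff] at h ⊢
  obtain ⟨Φ, hΦ, rfl, hg⟩ := h
  refine ⟨fun q => N * Φ q + q * deriv Φ q, ?_, by simp, fun z => ?_⟩
  · exact (hΦ.const_mul _).add (differentiableOn_id.mul (hΦ.deriv Metric.isOpen_ball))
  · have hd := hasDerivAt_comp_ofComplex (Φ := fun q => q ^ N * Φ q)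
      ((differentiableOn_id.pow N).mul hΦ) hg z
    have hΦ' : HasDerivAt Φ (deriv Φ (qexp z)) (qexp z) :=
      (hΦ.differentiableAt (Metric.isOpen_ball.mem_nhds (qexp_mem_ball z))).hasDerivAt
    have hpow : (N : ℂ) * qexp z ^ (N - 1) * qexp z = N * qexp z ^ N := by
      rcases N with _ | N
      · simp
      · simp [pow_succ, mul_assoc]
    have hpi : (2 * π * Complex.I : ℂ) ≠ 0 := Complex.two_pi_I_ne_zero
    have hprod : deriv (fun q => q ^ N * Φ q) (qexp z) =
        N * qexp z ^ (N - 1) * Φ (qexp z) + qexp z ^ N * deriv Φ (qexp z) :=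
      ((hasDerivAt_pow N (qexp z)).mul hΦ').deriv
    rw [qderiv_eq, Derivative.normalizedDerivOfComplex, hd.deriv, hprod]
    field_simp
    linear_combination Φ (qexp z) * hpow

/-! ### Eisenstein series, the discriminant and modular forms of level one -/

lemma Eis_two : Eis 2 = EisensteinSeries.E2 := by
  ext z
  rw [EisensteinSeries.E2_eq_tsum_cexp,
    tsum_pnat_eq_tsum_succ (f := fun n => (ArithmeticFunction.sigma 1 n : ℂ) *
      Complex.exp (2 * π * Complex.I * z) ^ n)]
  simp [Eis, qexp, bernoulli_two]
  norm_num

lemma Eis_eq_E {k : ℕ} (hk : 3 ≤ k) (hk2 : Even k) : Eis k = ModularForm.E hk := by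
  ext z
  have h := EisensteinSeries.q_expansion_bernoulli hk hk2 z
  simp only [zpow_natCast] at h
  rw [h, tsum_pnat_eq_tsum_succ (f := fun n => (ArithmeticFunction.sigma (k - 1) n : ℂ) *
      Complex.exp (2 * π * Complex.I * z) ^ n)]
  simp [Eis, qexp]

lemma Disc_eq : Disc = ModularForm.discriminant := by
  ext z
  rw [ModularForm.discriminant_eq_E₄_cube_sub_E₆_sq, Disc, Eis_eq_E (by norm_num) ⟨2, rfl⟩,
    Eis_eq_E (by norm_num) ⟨3, rfl⟩]

lemma Disc_ne_zero (z : ℍ) : Disc z ≠ 0 := by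
  rw [Disc_eq]
  exact ModularForm.discriminant_ne_zero z

lemma Eis_four_pow_sub (z : ℍ) : Eis 4 z ^ 3 - Eis 6 z ^ 2 = 1728 * Disc z := by
  rw [Disc]
  ring

lemma mem_Mset_iff {w : ℤ} {f : ℍ → ℂ} : f ∈ Mset w ↔ ∃ F : ModularForm 𝒮ℒ w, ⇑F = f := by
  have hΓ : ((⊤ : Subgroup SL(2, ℤ)) : Subgroup (GL (Fin 2) ℝ)) = 𝒮ℒ :=
    (MonoidHom.range_eq_map _).symm
  constructor
  · rintro ⟨F, rfl⟩
    exact ⟨ModularForm.mcast rfl F hΓ.symm, rfl⟩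
  · rintro ⟨F, rfl⟩
    exact ⟨ModularForm.mcast rfl F hΓ, rfl⟩

lemma Mset_add {w : ℤ} {f g : ℍ → ℂ} (hf : f ∈ Mset w) (hg : g ∈ Mset w) : f + g ∈ Mset w := by
  rw [mem_Mset_iff] at *
  obtain ⟨F, rfl⟩ := hf
  obtain ⟨G, rfl⟩ := hg
  exact ⟨F + G, rfl⟩

lemma Mset_smul {w : ℤ} {f : ℍ → ℂ} (s : ℂ) (hf : f ∈ Mset w) : s • f ∈ Mset w := by
  rw [mem_Mset_iff] at *
  obtain ⟨F, rfl⟩ := hf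
  exact ⟨s • F, rfl⟩

lemma Mset_sub {w : ℤ} {f g : ℍ → ℂ} (hf : f ∈ Mset w) (hg : g ∈ Mset w) : f - g ∈ Mset w := by
  simpa [sub_eq_add_neg] using Mset_add hf (Mset_smul (-1) hg)

lemma Mset_mul {k l w : ℤ} {f g : ℍ → ℂ} (hf : f ∈ Mset k) (hg : g ∈ Mset l) (hw : w = k + l) :
    f * g ∈ Mset w := by
  subst hw
  rw [mem_Mset_iff] at *
  obtain ⟨F, rfl⟩ := hf
  obtain ⟨G, rfl⟩ := hg
  exact ⟨F.mul G, rfl⟩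

lemma Mset_one : (1 : ℍ → ℂ) ∈ Mset 0 :=
  mem_Mset_iff.mpr ⟨1, rfl⟩

lemma Mset_zero (w : ℤ) : (0 : ℍ → ℂ) ∈ Mset w :=
  mem_Mset_iff.mpr ⟨0, rfl⟩

lemma Mset_pow {k w : ℤ} {f : ℍ → ℂ} (hf : f ∈ Mset k) (n : ℕ) (hw : w = n * k) :
    f ^ n ∈ Mset w := by
  subst hw
  induction n with
  | zero => simpa using Mset_one
  | succ n ih => rw [pow_succ]; exact Mset_mul ih hf (by push_cast; ring)

lemma Eis_four_mem : Eis 4 ∈ Mset 4 :=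
  mem_Mset_iff.mpr ⟨ModularForm.E (by norm_num), (Eis_eq_E _ ⟨2, rfl⟩).symm⟩

lemma Eis_six_mem : Eis 6 ∈ Mset 6 :=
  mem_Mset_iff.mpr ⟨ModularForm.E (by norm_num), (Eis_eq_E _ ⟨3, rfl⟩).symm⟩

lemma Disc_mem : Disc ∈ Mset 12 := by
  have h : Disc = (1 / 1728 : ℂ) • (Eis 4 ^ 3 - Eis 6 ^ 2) := by
    ext z
    simp [Disc]
    ring
  rw [h]
  exact Mset_smul _ (Mset_sub (Mset_pow Eis_four_mem 3 rfl) (Mset_pow Eis_six_mem 2 rfl))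

lemma hasLeadingTerm_of_modularForm {w : ℤ} (F : ModularForm 𝒮ℒ w) :
    HasLeadingTerm F 0 ((qExpansion 1 F).coeff 0) :=
  ⟨fun n => (qExpansion 1 F).coeff n, rfl, fun z => by
    simpa [qexp_eq_qParam] using ModularForm.hasSum_qExpansion F one_pos one_mem_strictPeriods_SL z⟩

lemma exists_hasLeadingTerm_of_mem_Mset {w : ℤ} {f : ℍ → ℂ} (hf : f ∈ Mset w) :
    ∃ c, HasLeadingTerm f 0 c := by
  obtain ⟨F, rfl⟩ := mem_Mset_iff.mp hf
  exact ⟨_, hasLeadingTerm_of_modularForm F⟩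

lemma mdifferentiable_of_mem_Mset {w : ℤ} {f : ℍ → ℂ} (hf : f ∈ Mset w) :
    MDifferentiable 𝓘(ℂ) 𝓘(ℂ) f :=
  (exists_hasLeadingTerm_of_mem_Mset hf).choose_spec.mdifferentiable

lemma eq_zero_of_mem_Mset {w : ℤ} (hw : w < 12) {f : ℍ → ℂ} (hf : f ∈ Mset w)
    (h0 : HasLeadingTerm f 0 0) : f = 0 := by
  obtain ⟨F, rfl⟩ := mem_Mset_iff.mp hf
  have hc := (hasLeadingTerm_of_modularForm F).unique h0
  have : F = 0 := by
    refine ModularForm.sturm_bound_levelOne ?_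
    rw [Nat.div_eq_of_lt (by omega)]
    have h1 : ((1 : ℕ) : ℕ∞) ≤ (qExpansion 1 F).order :=
      PowerSeries.nat_le_order _ _ fun i hi => by
        rw [Nat.lt_one_iff] at hi
        rwa [hi]
    exact lt_of_lt_of_le (by norm_num) h1
  rw [this]
  rfl

lemma hasLeadingTerm_Eis_two : HasLeadingTerm (Eis 2) 0 1 :=
  ⟨fun m => if m = 0 then 1 else -24 * ArithmeticFunction.sigma 1 m, rfl, fun z => by
    rw [Eis_two]
    simpa [qexp] using EisensteinSeries.hasSum_qExpansion_E2 (z := z)⟩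

lemma hasLeadingTerm_Eis {k : ℕ} (hk : 3 ≤ k) (hk2 : Even k) : HasLeadingTerm (Eis k) 0 1 := by
  rw [Eis_eq_E hk hk2, ← EisensteinSeries.E_qExpansion_coeff_zero hk hk2]
  exact hasLeadingTerm_of_modularForm _

lemma hasLeadingTerm_Eis_four : HasLeadingTerm (Eis 4) 0 1 :=
  hasLeadingTerm_Eis (by norm_num) ⟨2, rfl⟩

lemma hasLeadingTerm_Eis_six : HasLeadingTerm (Eis 6) 0 1 :=
  hasLeadingTerm_Eis (by norm_num) ⟨3, rfl⟩

lemma hasLeadingTerm_Disc : HasLeadingTerm Disc 1 1 := by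
  refine ⟨fun n => (qExpansion 1 ModularForm.discriminant).coeff (n + 1),
    ModularForm.discriminant_qExpansion_coeff_one, fun z => ?_⟩
  have h := ModularForm.hasSum_qExpansion CuspForm.discriminant one_pos one_mem_strictPeriods_SL z
  rw [← hasSum_nat_add_iff' 1] at h
  have h0 : (qExpansion 1 CuspForm.discriminant).coeff 0 = 0 :=
    CuspFormClass.qExpansion_coeff_zero _ one_pos one_mem_strictPeriods_SL
  simp only [Finset.range_one, Finset.sum_singleton, h0] at h
  simpa [Disc_eq, qexp_eq_qParam, add_comm] using h

lemma mdifferentiable_Eis_two : MDifferentiable 𝓘(ℂ) 𝓘(ℂ) (Eis 2) :=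
  hasLeadingTerm_Eis_two.mdifferentiable

lemma mdifferentiable_Eis_four : MDifferentiable 𝓘(ℂ) 𝓘(ℂ) (Eis 4) :=
  hasLeadingTerm_Eis_four.mdifferentiable

lemma mdifferentiable_Eis_six : MDifferentiable 𝓘(ℂ) 𝓘(ℂ) (Eis 6) :=
  hasLeadingTerm_Eis_six.mdifferentiable

lemma mdifferentiable_Disc : MDifferentiable 𝓘(ℂ) 𝓘(ℂ) Disc :=
  hasLeadingTerm_Disc.mdifferentiable

lemma serre_eq (w : ℤ) (f : ℍ → ℂ) : serre w f = Derivative.serreDerivative w f := by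
  ext z
  simp only [serre, Derivative.serreDerivative, qderiv_eq, Eis_two]
  ring

lemma serre_eq_sub (w : ℤ) (f : ℍ → ℂ) : serre w f = qderiv f - ((w : ℂ) / 12) • (Eis 2 * f) := by
  ext z
  simp [serre]
  ring

lemma HasLeadingTerm.serre {g : ℍ → ℂ} {N : ℕ} {c : ℂ} (h : HasLeadingTerm g N c) (w : ℤ) :
    HasLeadingTerm (serre w g) N ((N - w / 12) * c) := by
  rw [serre_eq_sub]
  have h2 := hasLeadingTerm_Eis_two.mul h
  rw [zero_add, one_mul] at h2
  convert h.qderiv.sub (h2.smul _) using 1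
  ring

lemma mdifferentiable_serre {f : ℍ → ℂ} (hf : MDifferentiable 𝓘(ℂ) 𝓘(ℂ) f) (w : ℤ) :
    MDifferentiable 𝓘(ℂ) 𝓘(ℂ) (serre w f) := by
  rw [serre_eq]
  exact Derivative.serreDerivative_mdifferentiable _ hf

lemma serre_add {f g : ℍ → ℂ} (hf : MDifferentiable 𝓘(ℂ) 𝓘(ℂ) f)
    (hg : MDifferentiable 𝓘(ℂ) 𝓘(ℂ) g) (w : ℤ) : serre w (f + g) = serre w f + serre w g := by
  simp only [serre_eq, Derivative.serreDerivative_add _ _ _ hf hg]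

lemma serre_sub {f g : ℍ → ℂ} (hf : MDifferentiable 𝓘(ℂ) 𝓘(ℂ) f)
    (hg : MDifferentiable 𝓘(ℂ) 𝓘(ℂ) g) (w : ℤ) : serre w (f - g) = serre w f - serre w g := by
  simp only [serre_eq, Derivative.serreDerivative_sub _ _ _ hf hg]

lemma serre_smul {f : ℍ → ℂ} (hf : MDifferentiable 𝓘(ℂ) 𝓘(ℂ) f) (s : ℂ) (w : ℤ) :
    serre w (s • f) = s • serre w f := by
  simp only [serre_eq, Derivative.serreDerivative_smul _ _ _ hf]

lemma serre_mul {f g : ℍ → ℂ} (hf : MDifferentiable 𝓘(ℂ) 𝓘(ℂ) f)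
    (hg : MDifferentiable 𝓘(ℂ) 𝓘(ℂ) g) {w k l : ℤ} (hw : w = k + l) :
    serre w (f * g) = serre k f * g + f * serre l g := by
  subst hw
  simp only [serre_eq, Int.cast_add, Derivative.serreDerivative_mul _ _ _ _ hf hg]

section Slash

open scoped ModularForm

lemma mem_Mset_of_slash {w : ℤ} {f : ℍ → ℂ} {c : ℂ} (hinv : ∀ γ : SL(2, ℤ), f ∣[w] γ = f)
    (hlead : HasLeadingTerm f 0 c) : f ∈ Mset w := by
  refine mem_Mset_iff.mpr
    ⟨⟨⟨f, ?_⟩, hlead.mdifferentiable, ?_⟩, rfl⟩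
  · rintro A ⟨γ, rfl⟩
    exact hinv γ
  · intro x hx
    rw [Subgroup.IsArithmetic.isCusp_iff_isCusp_SL2Z] at hx
    rw [OnePoint.isBoundedAt_iff_forall_SL2Z hx]
    intro γ _
    rw [hinv γ]
    exact hlead.tendsto.isBigO_one ℝ

lemma slash_eq_of_mem_Mset {w : ℤ} {f : ℍ → ℂ} (hf : f ∈ Mset w) (γ : SL(2, ℤ)) :
    f ∣[w] γ = f := by
  obtain ⟨F, rfl⟩ := mem_Mset_iff.mp hf
  exact SlashInvariantFormClass.slash_action_eq F _ ⟨γ, rfl⟩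

lemma serre_mem_Mset {w k : ℤ} {f : ℍ → ℂ} (hf : f ∈ Mset w) (hk : k = w + 2) :
    serre w f ∈ Mset k := by
  subst hk
  obtain ⟨c, hc⟩ := exists_hasLeadingTerm_of_mem_Mset hf
  refine mem_Mset_of_slash (fun γ => ?_) (hc.serre w)
  rw [serre_eq]
  exact Derivative.serreDerivative_slash_invariant hc.mdifferentiable (slash_eq_of_mem_Mset hf γ)

lemma hasDerivAt_div_denom (γ : SL(2, ℤ)) (z : ℍ) :
    HasDerivAt ((fun z : ℍ => (γ 1 0 : ℂ) / denom γ z) ∘ ofComplex)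
      (-((γ 1 0 : ℂ) / denom γ z) ^ 2) z := by
  have h := (hasDerivAt_denom_zpow γ (-1) z).const_mul (γ 1 0 : ℂ)
  have hev : ((fun z : ℍ => (γ 1 0 : ℂ) / denom γ z) ∘ ofComplex) =ᶠ[nhds (z : ℂ)]
      fun w => (γ 1 0 : ℂ) * denom γ w ^ (-1 : ℤ) := by
    filter_upwards [isOpen_upperHalfPlaneSet.mem_nhds z.im_pos] with w hw
    simp [ofComplex_apply_of_im_pos hw, div_eq_mul_inv]
  refine (h.congr_of_eventuallyEq hev).congr_deriv ?_
  have hz := denom_ne_zero γ z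
  simp
  field_simp

lemma Eis_two_slash (γ : SL(2, ℤ)) : Eis 2 ∣[(2 : ℤ)] γ =
    Eis 2 + (6 / (π * Complex.I) : ℂ) • fun z : ℍ => (γ 1 0 : ℂ) / denom γ z := by
  rw [Eis_two, EisensteinSeries.E2_slash_action]
  ext z
  have hz := denom_ne_zero γ z
  simp only [EisensteinSeries.D2, riemannZeta_two, Pi.sub_apply, Pi.smul_apply, Pi.add_apply,
    smul_eq_mul]
  field_simp
  linear_combination (-6 * (γ 1 0 : ℂ)) * Complex.I_sq

lemma serre_Eis_two_mem : serre 1 (Eis 2) ∈ Mset 4 := by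
  refine mem_Mset_of_slash (fun γ => ?_) (hasLeadingTerm_Eis_two.serre 1)
  set j : ℍ → ℂ := fun z : ℍ => (γ 1 0 : ℂ) / denom γ z with hj
  have hjd : MDifferentiable 𝓘(ℂ) 𝓘(ℂ) j := fun z =>
    mdifferentiableAt_iff.mpr (hasDerivAt_div_denom γ z).differentiableAt
  have hqj : ∀ z, qderiv j z = (2 * π * Complex.I)⁻¹ * -j z ^ 2 := fun z => by
    rw [qderiv_eq, Derivative.normalizedDerivOfComplex, (hasDerivAt_div_denom γ z).deriv]
  have hsplit : serre 1 (Eis 2) = serre 2 (Eis 2) + (1 / 12 : ℂ) • (Eis 2 * Eis 2) := by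
    ext z
    simp [serre]
    ring
  have hmul : (Eis 2 * Eis 2) ∣[(4 : ℤ)] γ = (Eis 2 ∣[(2 : ℤ)] γ) * (Eis 2 ∣[(2 : ℤ)] γ) :=
    ModularForm.mul_slash_SL2 2 2 γ _ _
  have hser : serre 2 (Eis 2) ∣[(4 : ℤ)] γ = serre 2 (Eis 2 ∣[(2 : ℤ)] γ) := by
    rw [serre_eq, serre_eq]
    exact Derivative.serreDerivative_slash_equivariant (k := 2) mdifferentiable_Eis_two
  rw [hsplit, SlashAction.add_slash, ModularForm.SL_smul_slash, hser, hmul, Eis_two_slash,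
    serre_add mdifferentiable_Eis_two (hjd.const_smul _), serre_smul hjd]
  ext z
  simp only [Pi.add_apply, Pi.smul_apply, Pi.mul_apply, smul_eq_mul, serre, hqj, ← hj]
  have hpi : (π : ℂ) ≠ 0 := by exact_mod_cast Real.pi_ne_zero
  have hI := Complex.I_ne_zero
  field_simp
  push_cast
  ring

end Slash

/-! ### The Ramanujan identities -/

lemma serre_Eis_four : serre 4 (Eis 4) = (-1 / 3 : ℂ) • Eis 6 := by
  refine sub_eq_zero.mp (eq_zero_of_mem_Mset (w := 6) (by norm_num)
    (Mset_sub (serre_mem_Mset Eis_four_mem rfl) (Mset_smul _ Eis_six_mem)) ?_)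
  convert (hasLeadingTerm_Eis_four.serre 4).sub (hasLeadingTerm_Eis_six.smul (-1 / 3)) using 1
  norm_num

lemma serre_Eis_six : serre 6 (Eis 6) = (-1 / 2 : ℂ) • Eis 4 ^ 2 := by
  refine sub_eq_zero.mp (eq_zero_of_mem_Mset (w := 8) (by norm_num)
    (Mset_sub (serre_mem_Mset Eis_six_mem rfl) (Mset_smul _ (Mset_pow Eis_four_mem 2 rfl))) ?_)
  convert (hasLeadingTerm_Eis_six.serre 6).sub ((hasLeadingTerm_Eis_four.pow 2).smul (-1 / 2))
    using 1
  norm_num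

lemma serre_Disc : serre 12 Disc = 0 := by
  have h : Disc = (1 / 1728 : ℂ) • (Eis 4 * (Eis 4 * Eis 4) - Eis 6 * Eis 6) := by
    ext z
    simp [Disc]
    ring
  have h4 := mdifferentiable_Eis_four
  have h6 := mdifferentiable_Eis_six
  rw [h, serre_smul ((h4.mul (h4.mul h4)).sub (h6.mul h6)),
    serre_sub (h4.mul (h4.mul h4)) (h6.mul h6), serre_mul h4 (h4.mul h4) (w := 12) (k := 4) (l := 8) rfl,
    serre_mul h4 h4 (w := 8) (k := 4) (l := 4) rfl, serre_mul h6 h6 (w := 12) (k := 6) (l := 6) rfl,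
    serre_Eis_four, serre_Eis_six]
  ext z
  simp
  ring

lemma serre_Eis_two : serre 1 (Eis 2) = (-1 / 12 : ℂ) • Eis 4 := by
  refine sub_eq_zero.mp (eq_zero_of_mem_Mset (w := 4) (by norm_num)
    (Mset_sub serre_Eis_two_mem (Mset_smul _ Eis_four_mem)) ?_)
  convert (hasLeadingTerm_Eis_two.serre 1).sub (hasLeadingTerm_Eis_four.smul (-1 / 12)) using 1
  norm_num

lemma serre_Disc_pow (L : ℕ) : serre (12 * L) (Disc ^ L) = 0 := by
  induction L with
  | zero =>
    ext z
    simp [serre, qderiv_eq, Pi.one_def]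
  | succ L ih =>
    rw [pow_succ, serre_mul (mdifferentiable_Disc.pow L) mdifferentiable_Disc (k := 12 * L)
      (l := 12) (by push_cast; ring), ih, serre_Disc]
    simp

lemma serre_Disc_pow_mul {f : ℍ → ℂ} (hf : MDifferentiable 𝓘(ℂ) 𝓘(ℂ) f) (L : ℕ) {w k : ℤ}
    (hw : w = 12 * L + k) : serre w (Disc ^ L * f) = Disc ^ L * serre k f := by
  rw [serre_mul (mdifferentiable_Disc.pow L) hf hw, serre_Disc_pow, zero_mul, zero_add]

/-! ### Extremal quasimodular forms of depth one -/

lemma HasLeadingTerm.of_lt {g : ℍ → ℂ} {N M : ℕ} {c : ℂ} (h : HasLeadingTerm g N c)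
    (hM : M < N) : HasLeadingTerm g M 0 := by
  rw [hasLeadingTerm_iff] at h ⊢
  obtain ⟨Φ, hΦ, rfl, hg⟩ := h
  refine ⟨fun q => q ^ (N - M) * Φ q, (differentiableOn_id.pow _).mul hΦ, ?_, fun z => ?_⟩
  · simp [Nat.sub_ne_zero_of_lt hM]
  · rw [hg, ← mul_assoc, ← pow_add, Nat.add_sub_cancel' hM.le]

lemma HasLeadingTerm.unit_mul {g g' : ℍ → ℂ} {N : ℕ} {c : ℂ} (h : HasLeadingTerm g 0 1)
    (h' : HasLeadingTerm g' N c) : HasLeadingTerm (g * g') N c := by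
  simpa using h.mul h'

/-- `u` solves `∂_{w-1}^2 u = ((w^2-1)/144) E_4 u`. -/
def SolvesKanekoZagier (w : ℤ) (u : ℍ → ℂ) : Prop :=
  serre (w + 1) (serre (w - 1) u) = (((w : ℂ) ^ 2 - 1) / 144) • (Eis 4 * u)

/-- The operator raising the weight of solutions of the Kaneko–Zagier equation by `6`. -/
noncomputable def raise (w : ℤ) (u : ℍ → ℂ) : ℍ → ℂ :=
  Eis 4 * serre (w - 1) u - (((w : ℂ) + 1) / 12) • (Eis 6 * u)

lemma serre_raise {w : ℤ} {u : ℍ → ℂ} (hu : MDifferentiable 𝓘(ℂ) 𝓘(ℂ) u)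
    (h : SolvesKanekoZagier w u) : serre (w + 5) (raise w u) =
      (((w : ℂ) + 5) / 12) • ((((w : ℂ) + 1) / 12) • (Eis 4 * Eis 4 * u) -
        Eis 6 * serre (w - 1) u) := by
  have h4 := mdifferentiable_Eis_four
  have h6 := mdifferentiable_Eis_six
  have hV := mdifferentiable_serre hu (w - 1)
  rw [raise, serre_sub (h4.mul hV) ((h6.mul hu).const_smul _), serre_smul (h6.mul hu),
    serre_mul h4 hV (w := w + 5) (k := 4) (l := w + 1) (by ring),
    serre_mul h6 hu (w := w + 5) (k := 6) (l := w - 1) (by ring), serre_Eis_four, serre_Eis_six, h]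
  ext z
  simp
  ring

lemma SolvesKanekoZagier.raise {w : ℤ} {u : ℍ → ℂ} (hu : MDifferentiable 𝓘(ℂ) 𝓘(ℂ) u)
    (h : SolvesKanekoZagier w u) : SolvesKanekoZagier (w + 6) (raise w u) := by
  have h4 := mdifferentiable_Eis_four
  have h6 := mdifferentiable_Eis_six
  have hV := mdifferentiable_serre hu (w - 1)
  rw [SolvesKanekoZagier, show w + 6 - 1 = w + 5 by ring, serre_raise hu h,
    serre_smul ((((h4.mul h4).mul hu).const_smul _).sub (h6.mul hV)),
    serre_sub (((h4.mul h4).mul hu).const_smul _) (h6.mul hV), serre_smul ((h4.mul h4).mul hu),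
    serre_mul (h4.mul h4) hu (w := w + 6 + 1) (k := 8) (l := w - 1) (by ring),
    serre_mul h6 hV (w := w + 6 + 1) (k := 6) (l := w + 1) (by ring),
    serre_mul h4 h4 (w := 8) (k := 4) (l := 4) rfl, serre_Eis_four, serre_Eis_six, h]
  ext z
  simp [_root_.raise]
  ring

lemma raise_ne_zero {w : ℤ} {u : ℍ → ℂ} (hu : MDifferentiable 𝓘(ℂ) 𝓘(ℂ) u)
    (h : SolvesKanekoZagier w u) (hu0 : u ≠ 0) (hw : (w : ℂ) + 1 ≠ 0) (hw' : (w : ℂ) + 5 ≠ 0) :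
    raise w u ≠ 0 := by
  intro h0
  have hs := serre_raise hu h
  rw [h0] at hs
  refine hu0 (funext fun z => ?_)
  have e0 : Eis 4 z * serre (w - 1) u z - ((w : ℂ) + 1) / 12 * (Eis 6 z * u z) = 0 := by
    simpa [raise] using congrFun h0 z
  have e1 : (((w : ℂ) + 5) / 12) * ((((w : ℂ) + 1) / 12) * (Eis 4 z * Eis 4 z * u z) -
        Eis 6 z * serre (w - 1) u z) = 0 := by
    have hz : serre (w + 5) 0 = 0 := by
      simpa using serre_smul mdifferentiable_Eis_two 0 (w + 5)
    simpa [hz] using (congrFun hs z).symm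
  have e2 := (mul_eq_zero.mp e1).resolve_left (div_ne_zero hw' (by norm_num))
  have e3 : ((w : ℂ) + 1) / 12 * (1728 * Disc z) * u z = 0 := by
    rw [← Eis_four_pow_sub]
    linear_combination Eis 4 z * e2 + Eis 6 z * e0
  simpa [hw, Disc_ne_zero z] using e3

lemma SolvesKanekoZagier.indicial {w : ℤ} {u : ℍ → ℂ} (h : SolvesKanekoZagier w u) {N : ℕ}
    {c : ℂ} (hc : c ≠ 0) (hN : HasLeadingTerm u N c) : N = 0 ∨ 6 * (N : ℤ) = w := by
  have h1 := (hN.serre (w - 1)).serre (w + 1)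
  have h2 := (hasLeadingTerm_Eis_four.unit_mul hN).smul (((w : ℂ) ^ 2 - 1) / 144)
  rw [h] at h1
  have h3 := h1.unique h2
  have h4 : ((N : ℂ) * (6 * N - w)) * c = 0 := by
    push_cast at h3
    linear_combination 6 * h3
  rcases mul_eq_zero.mp ((mul_eq_zero.mp h4).resolve_right hc) with h5 | h5
  · exact Or.inl (by exact_mod_cast h5)
  · exact Or.inr (by exact_mod_cast sub_eq_zero.mp h5)

lemma serre_depth_one {h₀ h₁ : ℍ → ℂ} (hd₀ : MDifferentiable 𝓘(ℂ) 𝓘(ℂ) h₀)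
    (hd₁ : MDifferentiable 𝓘(ℂ) 𝓘(ℂ) h₁) (w : ℤ) :
    serre (w - 1) (Eis 2 * h₁ + h₀) = Eis 2 * (serre (w - 2) h₁ + (1 / 12 : ℂ) • h₀) +
      (serre w h₀ - (1 / 12 : ℂ) • (Eis 4 * h₁)) := by
  rw [serre_add (mdifferentiable_Eis_two.mul hd₁) hd₀,
    serre_mul mdifferentiable_Eis_two hd₁ (w := w - 1) (k := 1) (l := w - 2) (by ring),
    serre_Eis_two]
  ext z
  simp [serre]
  ring

/-- In every weight `6n` there is an extremal quasimodular form of depth one solving the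
Kaneko–Zagier equation. -/
theorem exists_extremal (n : ℕ) : ∃ h₀ ∈ Mset (6 * n), ∃ h₁ ∈ Mset (6 * n - 2), ∃ c d : ℂ, c ≠ 0 ∧
    HasLeadingTerm (Eis 2 * h₁ + h₀) n c ∧ HasLeadingTerm h₁ 0 d ∧ (d = 0 ↔ n = 0) ∧
    SolvesKanekoZagier (6 * n) (Eis 2 * h₁ + h₀) := by
  induction n with
  | zero =>
    refine ⟨1, Mset_one, 0, Mset_zero _, 1, 0, one_ne_zero, ?_, ⟨0, rfl, fun z => by simp⟩,
      by simp, ?_⟩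
    · simpa using hasLeadingTerm_one
    · have h1 : serre (6 * (0 : ℕ) - 1) (Eis 2 * 0 + 1) = (1 / 12 : ℂ) • Eis 2 := by
        ext z
        simp [serre, qderiv_eq, Pi.one_def]
        ring
      rw [SolvesKanekoZagier, h1, serre_smul mdifferentiable_Eis_two,
        show (6 * ((0 : ℕ) : ℤ) + 1) = 1 by simp, serre_Eis_two]
      ext z
      simp
      ring
  | succ n ih =>
    obtain ⟨h₀, hm₀, h₁, hm₁, c, d, hc, hF, hl₁, hd, hsol⟩ := ih
    set F := Eis 2 * h₁ + h₀ with hFdef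
    set w : ℤ := 6 * n with hw
    have hd₀ := mdifferentiable_of_mem_Mset hm₀
    have hd₁ := mdifferentiable_of_mem_Mset hm₁
    have hFd := hF.mdifferentiable
    obtain ⟨e, he⟩ := exists_hasLeadingTerm_of_mem_Mset hm₀
    have hde : HasLeadingTerm F 0 (d + e) := by
      simpa using (hasLeadingTerm_Eis_two.unit_mul hl₁).add he
    have hwC : (w : ℂ) = 6 * n := by rw [hw]; push_cast; ring
    have hF0 : F ≠ 0 := fun h => hc (by rw [h] at hF; exact hF.eq_zero)
    have hw' : ((6 * (n + 1 : ℕ) : ℤ)) = w + 6 := by push_cast; ring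
    have hsplit : raise w F = Eis 2 * (Eis 4 * (serre (w - 2) h₁ + (1 / 12 : ℂ) • h₀) -
        (((w : ℂ) + 1) / 12) • (Eis 6 * h₁)) + (Eis 4 * (serre w h₀ - (1 / 12 : ℂ) • (Eis 4 * h₁)) -
        (((w : ℂ) + 1) / 12) • (Eis 6 * h₀)) := by
      rw [raise, hFdef, serre_depth_one hd₀ hd₁]
      ext z
      simp
      ring
    have hne : raise w F ≠ 0 := by
      refine raise_ne_zero hFd hsol hF0 ?_ ?_ <;> rw [hwC] <;> norm_cast
    have hlead : HasLeadingTerm (raise w F) n 0 := by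
      rw [raise]
      convert (hasLeadingTerm_Eis_four.unit_mul (hF.serre (w - 1))).sub
        ((hasLeadingTerm_Eis_six.unit_mul hF).smul (((w : ℂ) + 1) / 12)) using 1
      push_cast
      rw [hwC]
      ring
    obtain ⟨M, hM, c', hc', hG⟩ := hlead.exists_lt_of_ne_zero hne
    have hMn : M = n + 1 := by
      have := (hsol.raise hFd).indicial hc' hG
      omega
    subst hMn
    have hl₁' := (hasLeadingTerm_Eis_four.unit_mul
      ((hl₁.serre (w - 2)).add (he.smul (1 / 12)))).sub
      ((hasLeadingTerm_Eis_six.unit_mul hl₁).smul (((w : ℂ) + 1) / 12))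
    refine ⟨_, ?_, _, ?_, c', _, hc', hsplit ▸ hG, hl₁', ?_, hsplit ▸ hw' ▸ hsol.raise hFd⟩
    · refine Mset_sub (Mset_mul Eis_four_mem (Mset_sub (serre_mem_Mset hm₀ rfl)
        (Mset_smul _ (Mset_mul Eis_four_mem hm₁ (by ring)))) (by push_cast; ring))
        (Mset_smul _ (Mset_mul Eis_six_mem hm₀ (by push_cast; ring)))
    · refine Mset_sub (Mset_mul Eis_four_mem (Mset_add (serre_mem_Mset hm₁ (by ring))
        (Mset_smul _ hm₀)) (by push_cast; ring))
        (Mset_smul _ (Mset_mul Eis_six_mem hm₁ (by push_cast; ring)))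
    · simp only [Nat.succ_ne_zero, iff_false]
      push_cast
      rw [hwC]
      rcases Nat.eq_zero_or_pos n with rfl | hn
      · obtain rfl := hd.mpr rfl
        have := hde.unique hF
        intro h
        apply hc
        rw [← this]
        linear_combination 12 * h
      · have := hde.unique (hF.of_lt hn)
        have hd0 : d ≠ 0 := fun h => hn.ne' (hd.mp h)
        have hn0 : (n : ℂ) ≠ 0 := by exact_mod_cast hn.ne'
        intro h
        refine mul_ne_zero hn0 hd0 ?_
        linear_combination (-1) * h + (1 / 12) * this

/-! ### The second order equations -/

/-- The operator `f ↦ p ∂_{w-1}^2 f + r ∂_{w-1} f - s f`. -/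
noncomputable def secondOrder (p r s : ℍ → ℂ) (w : ℤ) (f : ℍ → ℂ) : ℍ → ℂ :=
  p * serre (w + 1) (serre (w - 1) f) + r * serre (w - 1) f - s * f

lemma secondOrder_sub_smul (p r s : ℍ → ℂ) (w : ℤ) {f g : ℍ → ℂ}
    (hf : MDifferentiable 𝓘(ℂ) 𝓘(ℂ) f) (hg : MDifferentiable 𝓘(ℂ) 𝓘(ℂ) g) (t : ℂ) :
    secondOrder p r s w (f - t • g) = secondOrder p r s w f - t • secondOrder p r s w g := by
  have h1 : serre (w - 1) (f - t • g) = serre (w - 1) f - t • serre (w - 1) g := by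
    rw [serre_sub hf (hg.const_smul t), serre_smul hg]
  have hf' := mdifferentiable_serre hf (w - 1)
  have hg' := mdifferentiable_serre hg (w - 1)
  have h2 : serre (w + 1) (serre (w - 1) (f - t • g)) =
      serre (w + 1) (serre (w - 1) f) - t • serre (w + 1) (serre (w - 1) g) := by
    rw [h1, serre_sub hf' (hg'.const_smul t), serre_smul hg']
  rw [secondOrder, h2, h1]
  ext z
  simp [secondOrder]
  ring

lemma HasLeadingTerm.secondOrder {p r s f : ℍ → ℂ} {r₀ s₀ c : ℂ} {N : ℕ}
    (hp : HasLeadingTerm p 0 1) (hr : HasLeadingTerm r 0 r₀) (hs : HasLeadingTerm s 0 s₀)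
    (hf : HasLeadingTerm f N c) (w : ℤ) : HasLeadingTerm (secondOrder p r s w f) N
      (((N - (w + 1) / 12) * (N - (w - 1) / 12) + r₀ * (N - (w - 1) / 12) - s₀) * c) := by
  have h := ((hp.mul ((hf.serre (w - 1)).serre (w + 1))).add (hr.mul (hf.serre (w - 1)))).sub
    (hs.mul hf)
  rw [zero_add] at h
  rw [_root_.secondOrder]
  convert h using 1
  push_cast
  ring

/-- Two solutions with the same vanishing order at `i∞` are proportional if this order is the
largest root of the indicial equation. -/
lemma eq_smul_of_secondOrder {p r s f F : ℍ → ℂ} {r₀ s₀ c c' : ℂ} {w : ℤ} {L n : ℕ}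
    (hp : HasLeadingTerm p 0 1) (hr : HasLeadingTerm r 0 r₀) (hs : HasLeadingTerm s 0 s₀)
    (hind : ∀ x : ℂ, (x - (w + 1) / 12) * (x - (w - 1) / 12) + r₀ * (x - (w - 1) / 12) - s₀ =
      (x - L) * (x - L - n))
    (hf : HasLeadingTerm f (L + n) c) (hF : HasLeadingTerm F (L + n) c') (hc' : c' ≠ 0)
    (hKf : secondOrder p r s w f = 0) (hKF : secondOrder p r s w F = 0) : f = (c / c') • F := by
  by_contra hne
  have hlead : HasLeadingTerm (f - (c / c') • F) (L + n) 0 := by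
    convert hf.sub (hF.smul (c / c')) using 1
    field_simp
    ring
  obtain ⟨N, hN, d, hd, hG⟩ := hlead.exists_lt_of_ne_zero (sub_ne_zero.mpr hne)
  have hK : secondOrder p r s w (f - (c / c') • F) = 0 := by
    rw [secondOrder_sub_smul _ _ _ _ hf.mdifferentiable hF.mdifferentiable, hKf, hKF]
    simp
  have h0 := hp.secondOrder hr hs hG w
  rw [hK, hind] at h0
  rcases mul_eq_zero.mp ((mul_eq_zero.mp h0.eq_zero).resolve_right hd) with h | h
  · have : N = L := by exact_mod_cast sub_eq_zero.mp h
    omega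
  · have : N = L + n := by
      have h' : (N : ℂ) = L + n := by linear_combination h
      exact_mod_cast h'
    omega

section Transfer

variable {v w : ℤ} {u : ℍ → ℂ} (L : ℕ)

lemma SolvesKanekoZagier.secondOrder_Disc_pow_mul (h : SolvesKanekoZagier v u)
    (hu : MDifferentiable 𝓘(ℂ) 𝓘(ℂ) u) (hw : w = 12 * L + v) :
    secondOrder 1 0 ((((v : ℂ) ^ 2 - 1) / 144) • Eis 4) w (Disc ^ L * u) = 0 := by
  rw [secondOrder, serre_Disc_pow_mul hu L (k := v - 1) (by omega),
    serre_Disc_pow_mul (mdifferentiable_serre hu _) L (k := v + 1) (by omega), h]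
  ext z
  simp
  ring

lemma SolvesKanekoZagier.secondOrder_Disc_pow_mul_serre (h : SolvesKanekoZagier v u)
    (hu : MDifferentiable 𝓘(ℂ) 𝓘(ℂ) u) (hw : w = 12 * L + v + 2) :
    secondOrder (Eis 4) ((1 / 3 : ℂ) • Eis 6) ((((v : ℂ) ^ 2 - 1) / 144) • Eis 4 ^ 2) w
      (Disc ^ L * serre (v - 1) u) = 0 := by
  have h4 := mdifferentiable_Eis_four
  rw [secondOrder, serre_Disc_pow_mul (mdifferentiable_serre hu _) L (k := v + 1) (by omega), h,
    serre_Disc_pow_mul ((h4.mul hu).const_smul _) L (k := v + 3) (by omega),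
    serre_smul (h4.mul hu), serre_mul h4 hu (w := v + 3) (k := 4) (l := v - 1) (by ring),
    serre_Eis_four]
  ext z
  simp
  ring

lemma SolvesKanekoZagier.secondOrder_Disc_pow_mul_Eis_four (h : SolvesKanekoZagier v u)
    (hu : MDifferentiable 𝓘(ℂ) 𝓘(ℂ) u) (hw : w = 12 * L + v + 4) :
    secondOrder (Eis 4 ^ 2) ((2 / 3 : ℂ) • (Eis 4 * Eis 6))
      ((((v : ℂ) ^ 2 - 1) / 144 - 1 / 18) • Eis 4 ^ 3 + (384 : ℂ) • Disc) w
      (Disc ^ L * (Eis 4 * u)) = 0 := by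
  have h4 := mdifferentiable_Eis_four
  have h6 := mdifferentiable_Eis_six
  have hV := mdifferentiable_serre hu (v - 1)
  have h1 : serre (v + 3) (Eis 4 * u) = (-1 / 3 : ℂ) • (Eis 6 * u) + Eis 4 * serre (v - 1) u := by
    rw [serre_mul h4 hu (w := v + 3) (k := 4) (l := v - 1) (by ring), serre_Eis_four, smul_mul_assoc]
  have hd : MDifferentiable 𝓘(ℂ) 𝓘(ℂ)
      ((-1 / 3 : ℂ) • (Eis 6 * u) + Eis 4 * serre (v - 1) u) :=
    ((h6.mul hu).const_smul _).add (h4.mul hV)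
  rw [secondOrder, serre_Disc_pow_mul (h4.mul hu) L (k := v + 3) (by omega), h1,
    serre_Disc_pow_mul hd L (k := v + 5) (by omega), serre_add ((h6.mul hu).const_smul _)
    (h4.mul hV), serre_smul (h6.mul hu),
    serre_mul h6 hu (w := v + 5) (k := 6) (l := v - 1) (by ring),
    serre_mul h4 hV (w := v + 5) (k := 4) (l := v + 1) (by ring), serre_Eis_four, serre_Eis_six, h]
  ext z
  simp
  linear_combination (-2 / 9 : ℂ) * Disc z ^ L * Eis 4 z * u z * -Eis_four_pow_sub z

end Transfer

/-! ### Dimensions -/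

lemma finrank_modularForm {k : ℕ} (hk : Even k) : Module.finrank ℂ (ModularForm 𝒮ℒ k) =
    if k % 12 = 2 then k / 12 else k / 12 + 1 := by
  refine Module.finrank_eq_of_rank_eq ?_
  rw [ModularForm.dimension_level_one k hk]
  simp only [Nat.ModEq, Nat.mod_eq_of_lt (show 2 < 12 by norm_num)]

/-- Modular forms of weight `w`, as functions. -/
def modularFormFun (w : ℤ) : ModularForm 𝒮ℒ w →ₗ[ℂ] ℍ → ℂ where
  toFun F := F
  map_add' _ _ := rfl
  map_smul' _ _ := rfl

lemma dimQM_zero (w : ℤ) : dimQM w 0 = Module.finrank ℂ (ModularForm 𝒮ℒ w) := by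
  have h : QM w 0 = LinearMap.range (modularFormFun w) := by
    rw [QM, ← Submodule.span_eq (LinearMap.range (modularFormFun w))]
    congr 1
    ext f
    constructor
    · rintro ⟨h, hh, hf⟩
      obtain ⟨F, hF⟩ := mem_Mset_iff.mp (hh 0 le_rfl)
      have hcast : w = w - 2 * ((0 : ℕ) : ℤ) := by simp
      refine ⟨ModularForm.mcast hcast.symm F, ?_⟩
      ext z
      rw [hf]
      simp [← hF, modularFormFun]
    · rintro ⟨F, rfl⟩
      exact ⟨fun _ => F, fun ℓ hℓ => by
        obtain rfl := Nat.le_zero.mp hℓ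
        exact mem_Mset_iff.mpr ⟨ModularForm.mcast (by simp) F, rfl⟩, fun z => by
        simp [modularFormFun]⟩
  rw [dimQM, h]
  exact LinearMap.finrank_range_of_inj fun F G hFG => DFunLike.coe_injective hFG

section Slash

open scoped ModularForm

lemma eq_zero_of_depth_one {w : ℤ} {h₀ h₁ : ℍ → ℂ} (hm₀ : h₀ ∈ Mset w) (hm₁ : h₁ ∈ Mset (w - 2))
    (h : Eis 2 * h₁ + h₀ = 0) : h₁ = 0 ∧ h₀ = 0 := by
  have hmul : (Eis 2 * h₁) ∣[w] ModularGroup.S =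
      (Eis 2 ∣[(2 : ℤ)] ModularGroup.S) * (h₁ ∣[w - 2] ModularGroup.S) := by
    have := ModularForm.mul_slash_SL2 2 (w - 2) ModularGroup.S (Eis 2) h₁
    rwa [add_sub_cancel] at this
  have hs : (Eis 2 * h₁ + h₀) ∣[w] ModularGroup.S = 0 := by
    rw [h, SlashAction.zero_slash]
  rw [SlashAction.add_slash, hmul, slash_eq_of_mem_Mset hm₀, slash_eq_of_mem_Mset hm₁,
    Eis_two_slash] at hs
  have h1 : h₁ = 0 := by
    ext z
    have e1 := congrFun h z
    have e2 := congrFun hs z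
    have hpi : (π : ℂ) ≠ 0 := by exact_mod_cast Real.pi_ne_zero
    have hz := z.ne_zero
    have e3 : (6 / (π * Complex.I) * (1 / z) : ℂ) * h₁ z = 0 := by
      simp only [Pi.add_apply, Pi.mul_apply, Pi.smul_apply, Pi.zero_apply, smul_eq_mul,
        ModularGroup.denom_S] at e1 e2
      simp [ModularGroup.S] at e2
      linear_combination e2 - e1
    simpa [hpi, hz] using e3
  exact ⟨h1, by simpa [h1] using h⟩

end Slash

lemma dimQM_one (w : ℤ) : dimQM w 1 = Module.finrank ℂ (ModularForm 𝒮ℒ w) +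
    Module.finrank ℂ (ModularForm 𝒮ℒ (w - 2)) := by
  let T : ModularForm 𝒮ℒ w × ModularForm 𝒮ℒ (w - 2) →ₗ[ℂ] ℍ → ℂ :=
    (modularFormFun w).coprod ((LinearMap.mulLeft ℂ (Eis 2)).comp (modularFormFun (w - 2)))
  have hT : ∀ F G, T (F, G) = F + Eis 2 * G := fun F G => rfl
  have hinj : Function.Injective T := by
    rw [← LinearMap.ker_eq_bot, LinearMap.ker_eq_bot']
    rintro ⟨F, G⟩ hFG
    rw [hT, add_comm] at hFG
    obtain ⟨hG, hF⟩ := eq_zero_of_depth_one (mem_Mset_iff.mpr ⟨F, rfl⟩) (mem_Mset_iff.mpr ⟨G, rfl⟩)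
      hFG
    exact Prod.ext (DFunLike.coe_injective hF) (DFunLike.coe_injective hG)
  have h : QM w 1 = LinearMap.range T := by
    rw [QM, ← Submodule.span_eq (LinearMap.range T)]
    congr 1
    ext f
    constructor
    · rintro ⟨h, hh, hf⟩
      obtain ⟨F, hF⟩ := mem_Mset_iff.mp (hh 0 zero_le_one)
      obtain ⟨G, hG⟩ := mem_Mset_iff.mp (hh 1 le_rfl)
      refine ⟨(ModularForm.mcast (by simp) F, ModularForm.mcast (by simp) G), ?_⟩
      ext z
      rw [hf, hT]
      simp [Finset.sum_range_succ, ← hF, ← hG]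
    · rintro ⟨⟨F, G⟩, rfl⟩
      refine ⟨fun ℓ => if ℓ = 0 then F else G, fun ℓ hℓ => ?_, fun z => ?_⟩
      · interval_cases ℓ
        · exact mem_Mset_iff.mpr ⟨ModularForm.mcast (by simp) F, rfl⟩
        · exact mem_Mset_iff.mpr ⟨ModularForm.mcast (by simp) G, rfl⟩
      · simp [hT, Finset.sum_range_succ]
  rw [dimQM, h, LinearMap.finrank_range_of_inj hinj, Module.finrank_prod]

lemma dimQM_one_eq {w : ℤ} {L n a : ℕ} (ha : a = 0 ∨ a = 2 ∨ a = 4) (hn : 1 ≤ n)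
    (hw : w = 12 * L + 6 * n + a) : dimQM w 1 = 2 * L + n + 1 ∧ L < dimQM (w - 2) 0 := by
  obtain rfl : w = ((12 * L + 6 * n + a : ℕ) : ℤ) := by rw [hw]; push_cast; ring
  have h2 : ((12 * L + 6 * n + a : ℕ) : ℤ) - 2 = ((12 * L + 6 * n + a - 2 : ℕ) : ℤ) := by omega
  rw [dimQM_one, dimQM_zero, h2, finrank_modularForm (Nat.even_iff.mpr (by omega)),
    finrank_modularForm (Nat.even_iff.mpr (by omega))]
  split_ifs <;> omega

/-! ### Balanced quasimodular forms of depth one -/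

lemma isBalancedQM_one {w : ℤ} {L n a : ℕ} (ha : a = 0 ∨ a = 2 ∨ a = 4) (hn : 1 ≤ n)
    (hw : w = 12 * L + 6 * n + a) {h₀ h₁ : ℍ → ℂ} (hm₀ : h₀ ∈ Mset w) (hm₁ : h₁ ∈ Mset (w - 2))
    {c d : ℂ} (hc : c ≠ 0) (hd : d ≠ 0) (hF : HasLeadingTerm (Eis 2 * h₁ + h₀) (L + n) c)
    (hl₁ : HasLeadingTerm h₁ L d) : IsBalancedQM w 1 (Eis 2 * h₁ + h₀) := by
  obtain ⟨hdim, hdim'⟩ := dimQM_one_eq ha hn hw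
  have hpi : (π : ℂ) ≠ 0 := by exact_mod_cast Real.pi_ne_zero
  refine ⟨fun ℓ => if ℓ = 0 then h₀ else h₁, fun ℓ => if ℓ = 0 then L + n else L, ?_, ?_, ?_, ?_,
    ?_, ?_, ?_⟩
  · intro ℓ hℓ
    interval_cases ℓ
    · simpa using hm₀
    · simpa using hm₁
  · rintro rfl
    exact hd (by simpa using hl₁.eq_zero)
  · intro z
    simp [Finset.sum_range_succ, add_comm]
  · intro ℓ hℓ
    interval_cases ℓ
    · convert hF.hasQExpansionAt hc using 1
      · ext z
        simp [gOf, Finset.sum_range_succ, add_comm]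
      · rfl
    · convert (hl₁.smul (6 / (π * Complex.I))).hasQExpansionAt
        (mul_ne_zero (by simp [hpi]) hd) using 1
      · ext z
        simp [gOf]
      · rfl
  · intro i j hij hj
    interval_cases j <;> interval_cases i <;> simp
  · intro ℓ hℓ
    interval_cases ℓ
    · simp [hdim]
      omega
    · simpa using hdim'
  · simp [Finset.sum_range_succ, hdim]
    omega

/-- A solution with maximal vanishing order is balanced as soon as some balanced form with this
vanishing order solves the equation. -/
lemma isBalancedQM_of_secondOrder {p r s f h₀ h₁ : ℍ → ℂ} {r₀ s₀ b c d : ℂ} {w : ℤ} {L n a : ℕ}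
    (ha : a = 0 ∨ a = 2 ∨ a = 4) (hn : 1 ≤ n) (hw : w = 12 * L + 6 * n + a)
    (hp : HasLeadingTerm p 0 1) (hr : HasLeadingTerm r 0 r₀) (hs : HasLeadingTerm s 0 s₀)
    (hind : ∀ x : ℂ, (x - (w + 1) / 12) * (x - (w - 1) / 12) + r₀ * (x - (w - 1) / 12) - s₀ =
      (x - L) * (x - L - n))
    (hm₀ : h₀ ∈ Mset w) (hm₁ : h₁ ∈ Mset (w - 2)) (hc : c ≠ 0) (hd : d ≠ 0)
    (hF : HasLeadingTerm (Eis 2 * h₁ + h₀) (L + n) c) (hl₁ : HasLeadingTerm h₁ L d)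
    (hKF : secondOrder p r s w (Eis 2 * h₁ + h₀) = 0)
    (hf : HasLeadingTerm f (L + n) b) (hb : b ≠ 0) (hKf : secondOrder p r s w f = 0) :
    IsBalancedQM w 1 f := by
  have hfF := eq_smul_of_secondOrder hp hr hs hind hf hF hc hKf hKF
  have hbc : b / c ≠ 0 := div_ne_zero hb hc
  have hsmul : (b / c) • (Eis 2 * h₁ + h₀) = Eis 2 * ((b / c) • h₁) + (b / c) • h₀ := by
    rw [smul_add, mul_smul_comm]
  rw [hfF, hsmul]
  exact isBalancedQM_one ha hn hw (Mset_smul _ hm₀) (Mset_smul _ hm₁) (mul_ne_zero hbc hc)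
    (mul_ne_zero hbc hd) (hsmul ▸ hF.smul _) (hl₁.smul _)

section Solutions

variable {w : ℤ} {L n : ℕ} {f : ℍ → ℂ} {b : ℂ}

lemma isBalancedQM_of_solution_zero (hn : 1 ≤ n) (hw : w = 12 * L + 6 * n)
    (hf : HasLeadingTerm f (L + n) b) (hb : b ≠ 0)
    (hK : secondOrder 1 0 (((((6 * n : ℤ) : ℂ) ^ 2 - 1) / 144) • Eis 4) w f = 0) :
    IsBalancedQM w 1 f := by
  obtain ⟨h₀, hm₀, h₁, hm₁, c, d, hc, hF, hl₁, hd, hsol⟩ := exists_extremal n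
  have hd0 : d ≠ 0 := fun h => by have := hd.mp h; omega
  have hD := hasLeadingTerm_Disc.pow L
  have hDm : Disc ^ L ∈ Mset (12 * L) := Mset_pow Disc_mem L (by ring)
  have hmul : Disc ^ L * (Eis 2 * h₁ + h₀) = Eis 2 * (Disc ^ L * h₁) + Disc ^ L * h₀ := by ring
  refine isBalancedQM_of_secondOrder (a := 0) (r₀ := 0) (by simp) hn (by simpa using hw) hasLeadingTerm_one
    ⟨0, rfl, fun z => by simp⟩ (hasLeadingTerm_Eis_four.smul _) (fun x => ?_)
    (Mset_mul hDm hm₀ hw) (Mset_mul hDm hm₁ (by rw [hw]; ring)) hc hd0 (hmul ▸ ?_) ?_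
    (hmul ▸ hsol.secondOrder_Disc_pow_mul L hF.mdifferentiable hw) hf hb hK
  · rw [hw]
    push_cast
    ring
  · simpa using hD.mul hl₁
  · simpa using hD.mul hF

lemma isBalancedQM_of_solution_two (hn : 1 ≤ n) (hw : w = 12 * L + 6 * n + 2)
    (hf : HasLeadingTerm f (L + n) b) (hb : b ≠ 0)
    (hK : secondOrder (Eis 4) ((1 / 3 : ℂ) • Eis 6)
      (((((6 * n : ℤ) : ℂ) ^ 2 - 1) / 144) • Eis 4 ^ 2) w f = 0) :
    IsBalancedQM w 1 f := by
  obtain ⟨h₀, hm₀, h₁, hm₁, c, d, hc, hF, hl₁, hd, hsol⟩ := exists_extremal n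
  obtain ⟨e, he⟩ := exists_hasLeadingTerm_of_mem_Mset hm₀
  have hde : d + e = 0 := by
    refine HasLeadingTerm.unique ?_ (hF.of_lt hn)
    exact (hasLeadingTerm_Eis_two.unit_mul hl₁).add he
  have hd0 : d ≠ 0 := fun h => by have := hd.mp h; omega
  have hD := hasLeadingTerm_Disc.pow L
  have hDm : Disc ^ L ∈ Mset (12 * L) := Mset_pow Disc_mem L (by ring)
  have hserre := serre_depth_one (mdifferentiable_of_mem_Mset hm₀)
    (mdifferentiable_of_mem_Mset hm₁) (6 * n)
  set g₁ := serre (6 * n - 2) h₁ + (1 / 12 : ℂ) • h₀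
  set g₀ := serre (6 * n) h₀ - (1 / 12 : ℂ) • (Eis 4 * h₁)
  have hg₁ : g₁ ∈ Mset (6 * n) :=
    Mset_add (serre_mem_Mset hm₁ (by ring)) (Mset_smul _ hm₀)
  have hg₀ : g₀ ∈ Mset (6 * n + 2) :=
    Mset_sub (serre_mem_Mset hm₀ rfl) (Mset_smul _ (Mset_mul Eis_four_mem hm₁ (by ring)))
  have hmul : Disc ^ L * serre (6 * n - 1) (Eis 2 * h₁ + h₀) =
      Eis 2 * (Disc ^ L * g₁) + Disc ^ L * g₀ := by
    rw [hserre]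
    ring
  refine isBalancedQM_of_secondOrder (a := 2) (by simp) hn (by simpa using hw)
    hasLeadingTerm_Eis_four (hasLeadingTerm_Eis_six.smul _)
    ((hasLeadingTerm_Eis_four.pow 2).smul _) (fun x => ?_)
    (Mset_mul hDm hg₀ (by rw [hw]; ring)) (Mset_mul hDm hg₁ (by rw [hw]; ring))
    (c := (n - ((6 * n - 1 : ℤ) : ℂ) / 12) * c)
    (d := (0 - ((6 * n - 2 : ℤ) : ℂ) / 12) * d + 1 / 12 * e) ?_ ?_ (hmul ▸ ?_) ?_
    (hmul ▸ hsol.secondOrder_Disc_pow_mul_serre L hF.mdifferentiable hw) hf hb hK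
  · rw [hw]
    push_cast
    ring
  · have h6 : (6 * n + 1 : ℂ) ≠ 0 := by exact_mod_cast (show 6 * n + 1 ≠ 0 by omega)
    intro h
    refine mul_ne_zero h6 hc ?_
    push_cast at h
    linear_combination 12 * h
  · have h6 : ((6 * n - 1 : ℤ) : ℂ) ≠ 0 := by exact_mod_cast (show (6 * n - 1 : ℤ) ≠ 0 by omega)
    intro h
    refine mul_ne_zero h6 hd0 ?_
    push_cast at h ⊢
    linear_combination (-12) * h + hde
  · have hg₁l : HasLeadingTerm g₁ 0 _ := (hl₁.serre (6 * n - 2)).add (he.smul (1 / 12))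
    simpa using hD.mul hg₁l
  · simpa using hD.mul (hF.serre (6 * n - 1))

lemma isBalancedQM_of_solution_four (hn : 1 ≤ n) (hw : w = 12 * L + 6 * n + 4)
    (hf : HasLeadingTerm f (L + n) b) (hb : b ≠ 0)
    (hK : secondOrder (Eis 4 ^ 2) ((2 / 3 : ℂ) • (Eis 4 * Eis 6))
      (((((6 * n : ℤ) : ℂ) ^ 2 - 1) / 144 - 1 / 18) • Eis 4 ^ 3 + (384 : ℂ) • Disc) w f = 0) :
    IsBalancedQM w 1 f := by
  obtain ⟨h₀, hm₀, h₁, hm₁, c, d, hc, hF, hl₁, hd, hsol⟩ := exists_extremal n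
  have hd0 : d ≠ 0 := fun h => by have := hd.mp h; omega
  have hD := hasLeadingTerm_Disc.pow L
  have hDm : Disc ^ L * Eis 4 ∈ Mset (12 * L + 4) :=
    Mset_mul (Mset_pow Disc_mem L rfl) Eis_four_mem (by ring)
  have hmul : Disc ^ L * (Eis 4 * (Eis 2 * h₁ + h₀)) =
      Eis 2 * (Disc ^ L * Eis 4 * h₁) + Disc ^ L * Eis 4 * h₀ := by ring
  refine isBalancedQM_of_secondOrder (a := 4) (by simp) hn (by simpa using hw)
    (by simpa using hasLeadingTerm_Eis_four.pow 2)
    ((hasLeadingTerm_Eis_four.mul hasLeadingTerm_Eis_six).smul _)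
    (((hasLeadingTerm_Eis_four.pow 3).smul _).add
      ((hasLeadingTerm_Disc.of_lt one_pos).smul _)) (fun x => ?_)
    (Mset_mul hDm hm₀ (by rw [hw]; ring)) (Mset_mul hDm hm₁ (by rw [hw]; ring)) hc hd0
    (hmul ▸ ?_) ?_ (hmul ▸ hsol.secondOrder_Disc_pow_mul_Eis_four L hF.mdifferentiable hw) hf hb hK
  · rw [hw]
    push_cast
    ring
  · simpa using (hD.mul hasLeadingTerm_Eis_four).mul hl₁
  · simpa using hD.mul (hasLeadingTerm_Eis_four.mul hF)

end Solutions

/-! ### Fundamental systems -/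

/-- Holomorphic functions with vanishing Wronskian are proportional. -/
lemma exists_eq_smul_of_serre_mul_eq {f g : ℍ → ℂ} (hf : MDifferentiable 𝓘(ℂ) 𝓘(ℂ) f)
    (hg : MDifferentiable 𝓘(ℂ) 𝓘(ℂ) g) (hg0 : g ≠ 0) {w : ℤ}
    (h : serre w f * g = f * serre w g) : ∃ c : ℂ, f = c • g := by
  obtain ⟨z₀, hz₀⟩ := Function.ne_iff.mp hg0
  have hpi : (2 * π * Complex.I)⁻¹ ≠ 0 := by simp [Real.pi_ne_zero]
  have hderiv (z : ℍ) : deriv (f ∘ ofComplex) z * g z = f z * deriv (g ∘ ofComplex) z := by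
    have hz := congrFun h z
    simp only [Pi.mul_apply, serre, qderiv_eq, Derivative.normalizedDerivOfComplex] at hz
    refine mul_left_cancel₀ hpi ?_
    linear_combination hz
  have hgc : ContinuousAt (g ∘ ofComplex) z₀ := (mdifferentiableAt_iff.mp (hg z₀)).continuousAt
  have hU : ∀ᶠ x : ℂ in nhds (z₀ : ℂ), 0 < x.im ∧ (g ∘ ofComplex) x ≠ 0 :=
    (isOpen_upperHalfPlaneSet.eventually_mem z₀.im_pos).and
      (hgc.eventually_ne (by simpa [ofComplex_apply] using hz₀))
  obtain ⟨ε, hε, hball⟩ := Metric.eventually_nhds_iff_ball.mp hU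
  have hquot {x : ℂ} (hx : x ∈ Metric.ball (z₀ : ℂ) ε) :
      HasDerivAt (fun y => (f ∘ ofComplex) y / (g ∘ ofComplex) y) 0 x := by
    obtain ⟨him, hgx⟩ := hball x hx
    have hfd := (mdifferentiableAt_iff.mp (hf ⟨x, him⟩)).hasDerivAt
    have hgd := (mdifferentiableAt_iff.mp (hg ⟨x, him⟩)).hasDerivAt
    refine (hfd.div hgd hgx).congr_deriv ?_
    have hx' := hderiv ⟨x, him⟩
    simp only [Function.comp_apply, ofComplex_apply_of_im_pos him] at hx' ⊢
    rw [hx', sub_self, zero_div]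
  obtain ⟨c, hc⟩ := Metric.isOpen_ball.exists_is_const_of_deriv_eq_zero
    (convex_ball _ _).isPreconnected (fun x hx => (hquot hx).differentiableAt.differentiableWithinAt)
    (fun x hx => (hquot hx).deriv)
  refine ⟨c, sub_eq_zero.mp (eq_zero_of_frequently (hf.sub (hg.const_smul c)) (τ := z₀) ?_)⟩
  refine Filter.Eventually.frequently (Filter.Eventually.filter_mono nhdsWithin_le_nhds ?_)
  filter_upwards [continuous_coe.continuousAt (Metric.ball_mem_nhds (z₀ : ℂ) hε)] with z hz
  have hgz := (hball z hz).2
  have hcz := hc z hz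
  simp only [Function.comp_apply, ofComplex_apply] at hgz hcz
  rw [div_eq_iff hgz] at hcz
  simp [hcz]

/-- The Wronskian of two solutions satisfies a first order equation. -/
lemma mul_serre_wronskian {p r s f g : ℍ → ℂ} {w : ℤ} (hf : MDifferentiable 𝓘(ℂ) 𝓘(ℂ) f)
    (hg : MDifferentiable 𝓘(ℂ) 𝓘(ℂ) g) (hKf : secondOrder p r s w f = 0)
    (hKg : secondOrder p r s w g = 0) :
    p * serre (2 * w) (f * serre (w - 1) g - g * serre (w - 1) f) =
      -r * (f * serre (w - 1) g - g * serre (w - 1) f) := by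
  have hf' := mdifferentiable_serre hf (w - 1)
  have hg' := mdifferentiable_serre hg (w - 1)
  rw [serre_sub (hf.mul hg') (hg.mul hf'),
    serre_mul hf hg' (k := w - 1) (l := w + 1) (by ring),
    serre_mul hg hf' (k := w - 1) (l := w + 1) (by ring)]
  rw [secondOrder] at hKf hKg
  linear_combination f * hKg - g * hKf

lemma isFundamentalSystem_secondOrder {p r s f₀ f₁ : ℍ → ℂ} {w : ℤ}
    (hp : MDifferentiable 𝓘(ℂ) 𝓘(ℂ) p) (hp0 : p ≠ 0) (hf₀ : MDifferentiable 𝓘(ℂ) 𝓘(ℂ) f₀)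
    (hf₁ : MDifferentiable 𝓘(ℂ) 𝓘(ℂ) f₁) (hK₀ : secondOrder p r s w f₀ = 0)
    (hK₁ : secondOrder p r s w f₁ = 0) (hT₀ : ∀ z, f₀ (Tact z) = f₀ z)
    (hT₁ : ∀ z, f₁ (Tact z) = f₁ z + f₀ z) (hne : f₀ ≠ 0) :
    IsFundamentalSystem (secondOrder p r s w) ![f₀, f₁] := by
  have hrel {a b : ℂ} (hab : a • f₀ + b • f₁ = 0) : a = 0 ∧ b = 0 := by
    have hb : b • f₀ = 0 := by
      ext z
      have h1 := congrFun hab z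
      have h2 := congrFun hab (Tact z)
      simp only [Pi.add_apply, Pi.smul_apply, smul_eq_mul, Pi.zero_apply, hT₀, hT₁] at h1 h2 ⊢
      linear_combination h2 - h1
    have hb0 : b = 0 := (smul_eq_zero.mp hb).resolve_right hne
    subst hb0
    simpa [hne] using hab
  have hW {g : ℍ → ℂ} (hg : MDifferentiable 𝓘(ℂ) 𝓘(ℂ) g) :
      MDifferentiable 𝓘(ℂ) 𝓘(ℂ) (f₀ * serre (w - 1) g - g * serre (w - 1) f₀) :=
    (hf₀.mul (mdifferentiable_serre hg _)).sub (hg.mul (mdifferentiable_serre hf₀ _))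
  refine ⟨Fin.forall_fin_two.mpr ⟨hf₀, hf₁⟩, Fin.forall_fin_two.mpr ⟨hK₀, hK₁⟩,
    LinearIndependent.pair_iff.mpr fun a b => hrel, fun g hg hKg => ?_⟩
  have hW0 : f₀ * serre (w - 1) f₁ - f₁ * serre (w - 1) f₀ ≠ 0 := by
    intro h
    obtain ⟨c, hc⟩ := exists_eq_smul_of_serre_mul_eq hf₁ hf₀ hne (w := w - 1)
      (by linear_combination h)
    have := (hrel (a := -c) (b := 1) (by ext z; simp [hc])).2
    exact one_ne_zero this
  have hE₁ := mul_serre_wronskian hf₀ hf₁ hK₀ hK₁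
  have hEg := mul_serre_wronskian hf₀ hg hK₀ hKg
  obtain ⟨β, hβ⟩ := exists_eq_smul_of_serre_mul_eq (hW hg) (hW hf₁) hW0 (w := 2 * w) <|
    sub_eq_zero.mp <| ((mul_eq_zero_iff hp
      (((mdifferentiable_serre (hW hg) _).mul (hW hf₁)).sub
        ((hW hg).mul (mdifferentiable_serre (hW hf₁) _)))).mp (by
        linear_combination (f₀ * serre (w - 1) f₁ - f₁ * serre (w - 1) f₀) * hEg -
          (f₀ * serre (w - 1) g - g * serre (w - 1) f₀) * hE₁)).resolve_left hp0
  obtain ⟨α, hα⟩ := exists_eq_smul_of_serre_mul_eq (hg.sub (hf₁.const_smul β)) hf₀ hne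
    (w := w - 1) (by
      rw [serre_sub hg (hf₁.const_smul β), serre_smul hf₁]
      ext z
      have hz := congrFun hβ z
      simp only [Pi.sub_apply, Pi.mul_apply, Pi.smul_apply, smul_eq_mul] at hz ⊢
      linear_combination hz)
  have hspan : g = α • f₀ + β • f₁ := by rw [← hα, sub_add_cancel]
  rw [hspan]
  exact Submodule.add_mem _
    (Submodule.smul_mem _ _ (Submodule.subset_span ⟨0, rfl⟩))
    (Submodule.smul_mem _ _ (Submodule.subset_span ⟨1, rfl⟩))

lemma qderiv_const_mul_coe (t : ℂ) :
    qderiv (fun z : ℍ => t * (z : ℂ)) = fun _ => (2 * π * Complex.I)⁻¹ * t := by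
  ext z
  rw [qderiv_eq, Derivative.normalizedDerivOfComplex]
  congr 1
  refine HasDerivAt.deriv (HasDerivAt.congr_of_eventuallyEq (f := fun x : ℂ => t * x) ?_ ?_)
  · simpa using (hasDerivAt_id (z : ℂ)).const_mul t
  · filter_upwards [isOpen_upperHalfPlaneSet.mem_nhds z.im_pos] with x hx
    have hx' : 0 < x.im := hx
    simp [ofComplex_apply_of_im_pos hx']

lemma mdifferentiable_const_mul_coe (t : ℂ) :
    MDifferentiable 𝓘(ℂ) 𝓘(ℂ) (fun z : ℍ => t * (z : ℂ)) :=
  mdifferentiable_coe.const_smul t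

lemma qderiv_const (t : ℂ) : qderiv (fun _ => t) = fun _ => 0 := by
  rw [qderiv_eq, Derivative.normalizedDerivOfComplex_const]
  rfl

/-- Functions with constant derivative solve the Kaneko–Zagier equation of weight zero. -/
lemma solvesKanekoZagier_zero {u : ℍ → ℂ} (hu : MDifferentiable 𝓘(ℂ) 𝓘(ℂ) u) {κ : ℂ}
    (hκ : qderiv u = fun _ => κ) : SolvesKanekoZagier 0 u := by
  have h2 := mdifferentiable_Eis_two
  have hconst : MDifferentiable 𝓘(ℂ) 𝓘(ℂ) (fun _ : ℍ => κ) := mdifferentiable_const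
  have h1 : serre (0 - 1) u = (fun _ => κ) + (1 / 12 : ℂ) • (Eis 2 * u) := by
    ext z
    simp [serre, hκ]
    ring
  rw [SolvesKanekoZagier, h1, serre_add hconst ((h2.mul hu).const_smul _),
    serre_smul (h2.mul hu), serre_mul h2 hu (k := 1) (l := 0) (by ring), serre_Eis_two]
  ext z
  simp [serre, hκ, qderiv_const]
  ring

lemma HasLeadingTerm.apply_Tact {g : ℍ → ℂ} {N : ℕ} {c : ℂ} (h : HasLeadingTerm g N c) (z : ℍ) :
    g (Tact z) = g z := by
  have hq : qexp (Tact z) = qexp z := by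
    rw [qexp, qexp, show ((Tact z : ℍ) : ℂ) = z + 1 from rfl, mul_add, mul_one, Complex.exp_add,
      Complex.exp_two_pi_mul_I, mul_one]
  obtain ⟨a, -, ha⟩ := h
  exact (hq ▸ ha (Tact z)).unique (ha z)

lemma HasLeadingTerm.ne_zero {g : ℍ → ℂ} {N : ℕ} {c : ℂ} (h : HasLeadingTerm g N c) (hc : c ≠ 0) :
    g ≠ 0 := by
  rintro rfl
  exact hc h.eq_zero

section Degenerate

variable {w : ℤ} (L : ℕ)

lemma isFundamentalSystem_zero (hw : w = 12 * L) :
    IsFundamentalSystem (secondOrder 1 0 (((((0 : ℤ) : ℂ) ^ 2 - 1) / 144) • Eis 4) w)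
      ![fun z => Disc z ^ L, fun z => z * Disc z ^ L] := by
  have hD := hasLeadingTerm_Disc.pow L
  have hs₀ := solvesKanekoZagier_zero mdifferentiable_const (qderiv_const 1)
  have hs₁ := solvesKanekoZagier_zero (mdifferentiable_const_mul_coe 1) (qderiv_const_mul_coe 1)
  have h₀ : (fun z => Disc z ^ L) = Disc ^ L * fun _ : ℍ => (1 : ℂ) := by
    ext z
    simp
  have h₁ : (fun z : ℍ => z * Disc z ^ L) = Disc ^ L * fun z : ℍ => 1 * (z : ℂ) := by
    ext z
    simp [mul_comm]
  refine isFundamentalSystem_secondOrder hasLeadingTerm_one.mdifferentiable one_ne_zero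
    hD.mdifferentiable ?_ ?_ ?_ hD.apply_Tact (fun z => ?_) (hD.ne_zero (by simp))
  · exact h₁ ▸ hD.mdifferentiable.mul (mdifferentiable_const_mul_coe 1)
  · exact h₀ ▸ hs₀.secondOrder_Disc_pow_mul L mdifferentiable_const (by omega)
  · exact h₁ ▸ hs₁.secondOrder_Disc_pow_mul L (mdifferentiable_const_mul_coe 1) (by omega)
  · rw [hasLeadingTerm_Disc.apply_Tact, show ((Tact z : ℍ) : ℂ) = z + 1 from rfl]
    ring

lemma isFundamentalSystem_two (hw : w = 12 * L + 2) :
    IsFundamentalSystem (secondOrder (Eis 4) ((1 / 3 : ℂ) • Eis 6)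
      (((((0 : ℤ) : ℂ) ^ 2 - 1) / 144) • Eis 4 ^ 2) w)
      ![fun z => Eis 2 z * Disc z ^ L,
        fun z => z * Eis 2 z * Disc z ^ L + 6 / (π * Complex.I) * Disc z ^ L] := by
  have hD := hasLeadingTerm_Disc.pow L
  have hD₂ := hasLeadingTerm_Eis_two.mul hD
  have hs₀ := solvesKanekoZagier_zero mdifferentiable_const (qderiv_const 12)
  have hs₁ := solvesKanekoZagier_zero (mdifferentiable_const_mul_coe 12) (qderiv_const_mul_coe 12)
  have hpi : (π : ℂ) ≠ 0 := by exact_mod_cast Real.pi_ne_zero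
  have h₀ : (fun z => Eis 2 z * Disc z ^ L) = Disc ^ L * serre (0 - 1) (fun _ => 12) := by
    ext z
    simp [serre, qderiv_const]
    ring
  have h₁ : (fun z : ℍ => z * Eis 2 z * Disc z ^ L + 6 / (π * Complex.I) * Disc z ^ L) =
      Disc ^ L * serre (0 - 1) (fun z => 12 * (z : ℂ)) := by
    ext z
    simp only [serre, qderiv_const_mul_coe, Pi.mul_apply, Pi.pow_apply]
    push_cast
    field_simp
    ring
  refine isFundamentalSystem_secondOrder mdifferentiable_Eis_four
    (hasLeadingTerm_Eis_four.ne_zero one_ne_zero) hD₂.mdifferentiable ?_ ?_ ?_ hD₂.apply_Tact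
    (fun z => ?_) (hD₂.ne_zero (by simp))
  · exact h₁ ▸ hD.mdifferentiable.mul (mdifferentiable_serre (mdifferentiable_const_mul_coe 12) _)
  · exact h₀ ▸ hs₀.secondOrder_Disc_pow_mul_serre L mdifferentiable_const (by omega)
  · exact h₁ ▸ hs₁.secondOrder_Disc_pow_mul_serre L (mdifferentiable_const_mul_coe 12) (by omega)
  · rw [hasLeadingTerm_Disc.apply_Tact, hasLeadingTerm_Eis_two.apply_Tact,
      show ((Tact z : ℍ) : ℂ) = z + 1 from rfl]
    ring

lemma isFundamentalSystem_four (hw : w = 12 * L + 4) :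
    IsFundamentalSystem (secondOrder (Eis 4 ^ 2) ((2 / 3 : ℂ) • (Eis 4 * Eis 6))
      (((((0 : ℤ) : ℂ) ^ 2 - 1) / 144 - 1 / 18) • Eis 4 ^ 3 + (384 : ℂ) • Disc) w)
      ![fun z => Eis 4 z * Disc z ^ L, fun z => z * Eis 4 z * Disc z ^ L] := by
  have hD := hasLeadingTerm_Eis_four.mul (hasLeadingTerm_Disc.pow L)
  have h4 := hasLeadingTerm_Eis_four.pow 2
  have hs₀ := solvesKanekoZagier_zero mdifferentiable_const (qderiv_const 1)
  have hs₁ := solvesKanekoZagier_zero (mdifferentiable_const_mul_coe 1) (qderiv_const_mul_coe 1)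
  have h₀ : (fun z => Eis 4 z * Disc z ^ L) = Disc ^ L * (Eis 4 * fun _ : ℍ => (1 : ℂ)) := by
    ext z
    simp [mul_comm]
  have h₁ : (fun z : ℍ => z * Eis 4 z * Disc z ^ L) =
      Disc ^ L * (Eis 4 * fun z : ℍ => 1 * (z : ℂ)) := by
    ext z
    simp [mul_comm]
  refine isFundamentalSystem_secondOrder h4.mdifferentiable (h4.ne_zero (by simp))
    hD.mdifferentiable ?_ ?_ ?_ hD.apply_Tact (fun z => ?_) (hD.ne_zero (by simp))
  · exact h₁ ▸ (hasLeadingTerm_Disc.pow L).mdifferentiable.mul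
      (mdifferentiable_Eis_four.mul (mdifferentiable_const_mul_coe 1))
  · exact h₀ ▸ hs₀.secondOrder_Disc_pow_mul_Eis_four L mdifferentiable_const (by omega)
  · exact h₁ ▸ hs₁.secondOrder_Disc_pow_mul_Eis_four L (mdifferentiable_const_mul_coe 1) (by omega)
  · rw [hasLeadingTerm_Disc.apply_Tact, hasLeadingTerm_Eis_four.apply_Tact,
      show ((Tact z : ℍ) : ℂ) = z + 1 from rfl]
    ring

end Degenerate

lemma serreIter_two (w : ℤ) (f : ℍ → ℂ) :
    serreIter (w - 1) 2 f = serre (w + 1) (serre (w - 1) f) := by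
  simp only [serreIter]
  congr 1
  · push_cast
    ring
  · congr 1
    simp

/-- Theorem 3 of the paper: modular differential equations with
balanced quasimodular solutions of depth `1`, for `w ≡ a (mod 6)`, `a ∈ {0,2,4}`. -/
theorem depth_one_equations (w a : ℤ) (ha : a = 0 ∨ a = 2 ∨ a = 4) (hw : w % 6 = a)
    (lam : ℕ) (h1 : ((w : ℚ) - a) / 12 ≤ (lam : ℚ)) (h2 : (lam : ℚ) ≤ ((w : ℚ) - a) / 6)
    (f : ℍ → ℂ) (hfhol : MDifferentiable 𝓘(ℂ) 𝓘(ℂ) f)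
    (c : ℕ → ℂ) (hc0 : c 0 ≠ 0)
    (hq : ∀ z : ℍ, HasSum (fun n : ℕ => c n * qexp z ^ (lam + n)) (f z)) :
    (a = 0 →
      ((∀ z : ℍ,
          serreIter (w - 1) 2 f z -
            (12 * (lam : ℂ) - w - 1) * (12 * (lam : ℂ) - w + 1) / 144 * Eis 4 z * f z = 0) →
        (((w : ℚ) / 12 < (lam : ℚ) → IsBalancedQM w 1 f) ∧
         ((lam : ℚ) = (w : ℚ) / 12 →
           IsFundamentalSystem
             (fun g : ℍ → ℂ => fun z : ℍ =>
               serreIter (w - 1) 2 g z -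
                 (12 * (lam : ℂ) - w - 1) * (12 * (lam : ℂ) - w + 1) / 144 * Eis 4 z * g z)
             ![fun z : ℍ => Disc z ^ (w / 12),
               fun z : ℍ => (z : ℂ) * Disc z ^ (w / 12)])))) ∧
    (a = 2 →
      ((∀ z : ℍ,
          Eis 4 z * serreIter (w - 1) 2 f z + (1 / 3 : ℂ) * Eis 6 z * serre (w - 1) f z -
            (12 * (lam : ℂ) - w + 1) * (12 * (lam : ℂ) - w + 3) / 144 * Eis 4 z ^ 2 * f z = 0) →
        ((((w : ℚ) - 2) / 12 < (lam : ℚ) → IsBalancedQM w 1 f) ∧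
         ((lam : ℚ) = ((w : ℚ) - 2) / 12 →
           IsFundamentalSystem
             (fun g : ℍ → ℂ => fun z : ℍ =>
               Eis 4 z * serreIter (w - 1) 2 g z + (1 / 3 : ℂ) * Eis 6 z * serre (w - 1) g z -
                 (12 * (lam : ℂ) - w + 1) * (12 * (lam : ℂ) - w + 3) / 144 * Eis 4 z ^ 2 * g z)
             ![fun z : ℍ => Eis 2 z * Disc z ^ ((w - 2) / 12),
               fun z : ℍ => (z : ℂ) * Eis 2 z * Disc z ^ ((w - 2) / 12) +
                 6 / ((Real.pi : ℂ) * Complex.I) * Disc z ^ ((w - 2) / 12)])))) ∧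
    (a = 4 →
      ((∀ z : ℍ,
          Eis 4 z ^ 2 * serreIter (w - 1) 2 f z +
            (2 / 3 : ℂ) * Eis 4 z * Eis 6 z * serre (w - 1) f z -
            (((12 * (lam : ℂ) - w + 3) * (12 * (lam : ℂ) - w + 5) / 144 - 1 / 18) * Eis 4 z ^ 3 +
              384 * Disc z) * f z = 0) →
        ((((w : ℚ) - 4) / 12 < (lam : ℚ) → IsBalancedQM w 1 f) ∧
         ((lam : ℚ) = ((w : ℚ) - 4) / 12 →
           IsFundamentalSystem
             (fun g : ℍ → ℂ => fun z : ℍ =>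
               Eis 4 z ^ 2 * serreIter (w - 1) 2 g z +
                 (2 / 3 : ℂ) * Eis 4 z * Eis 6 z * serre (w - 1) g z -
                 (((12 * (lam : ℂ) - w + 3) * (12 * (lam : ℂ) - w + 5) / 144 - 1 / 18) *
                     Eis 4 z ^ 3 + 384 * Disc z) * g z)
             ![fun z : ℍ => Eis 4 z * Disc z ^ ((w - 4) / 12),
               fun z : ℍ => (z : ℂ) * Eis 4 z * Disc z ^ ((w - 4) / 12)])))) := by
  have hwa : ((w : ℚ) - a) / 12 ≤ lam ∧ (lam : ℚ) ≤ ((w : ℚ) - a) / 6 := ⟨h1, h2⟩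
  rw [div_le_iff₀ (by norm_num), le_div_iff₀ (by norm_num)] at hwa
  have hlow : w - a ≤ lam * 12 := by exact_mod_cast hwa.1
  have hhigh : (lam : ℤ) * 6 ≤ w - a := by exact_mod_cast hwa.2
  obtain ⟨L, n, hlam, hwLn⟩ : ∃ L n : ℕ, lam = L + n ∧ w = 12 * L + 6 * n + a :=
    ⟨((w - a) / 6 - lam).toNat, (2 * lam - (w - a) / 6).toNat, by omega, by omega⟩
  clear hwa hlow hhigh h1 h2 hw
  have hf : HasLeadingTerm f (L + n) (c 0) := ⟨c, rfl, hlam ▸ hq⟩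
  have hlt {b : ℚ} (hb : b = a) (h : ((w : ℚ) - b) / 12 < lam) : 1 ≤ n := by
    by_contra hn
    obtain rfl : n = 0 := by omega
    rw [hb, hwLn, hlam] at h
    push_cast at h
    linarith
  have heq {b : ℚ} (hb : b = a) (h : (lam : ℚ) = ((w : ℚ) - b) / 12) : n = 0 := by
    rw [hb, hwLn, hlam] at h
    push_cast at h
    exact_mod_cast (by linarith : (n : ℚ) = 0)
  have hcoef : 12 * (lam : ℂ) - w = 6 * n - a := by
    rw [hlam, hwLn]
    push_cast
    ring
  refine ⟨?_, ?_, ?_⟩ <;> intro ha' hsol <;> subst ha'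
  · have hop : (fun g : ℍ → ℂ => fun z : ℍ => serreIter (w - 1) 2 g z -
        (12 * (lam : ℂ) - w - 1) * (12 * (lam : ℂ) - w + 1) / 144 * Eis 4 z * g z) =
        secondOrder 1 0 (((((6 * n : ℤ) : ℂ) ^ 2 - 1) / 144) • Eis 4) w := by
      ext g z
      simp [serreIter_two, secondOrder, hcoef]
      ring
    refine ⟨fun h => isBalancedQM_of_solution_zero (hlt (b := 0) (by simp) (by simpa using h))
      (by omega) hf hc0 (hop ▸ funext hsol), fun h => ?_⟩
    obtain rfl : n = 0 := heq (b := 0) (by simp) (by simpa using h)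
    rw [hop, show w / 12 = (L : ℤ) by omega]
    simpa only [zpow_natCast, Nat.cast_zero, mul_zero] using
      isFundamentalSystem_zero L (by omega : w = 12 * L)
  · have hop : (fun g : ℍ → ℂ => fun z : ℍ =>
        Eis 4 z * serreIter (w - 1) 2 g z + (1 / 3 : ℂ) * Eis 6 z * serre (w - 1) g z -
          (12 * (lam : ℂ) - w + 1) * (12 * (lam : ℂ) - w + 3) / 144 * Eis 4 z ^ 2 * g z) =
        secondOrder (Eis 4) ((1 / 3 : ℂ) • Eis 6)
          (((((6 * n : ℤ) : ℂ) ^ 2 - 1) / 144) • Eis 4 ^ 2) w := by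
      ext g z
      simp [serreIter_two, secondOrder, hcoef]
      ring
    refine ⟨fun h => isBalancedQM_of_solution_two (hlt (by simp) h) (by omega) hf hc0
      (hop ▸ funext hsol), fun h => ?_⟩
    obtain rfl : n = 0 := heq (by simp) h
    rw [hop, show (w - 2) / 12 = (L : ℤ) by omega]
    simpa only [zpow_natCast, Nat.cast_zero, mul_zero] using
      isFundamentalSystem_two L (by omega : w = 12 * L + 2)
  · have hop : (fun g : ℍ → ℂ => fun z : ℍ =>
        Eis 4 z ^ 2 * serreIter (w - 1) 2 g z +
          (2 / 3 : ℂ) * Eis 4 z * Eis 6 z * serre (w - 1) g z -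
          (((12 * (lam : ℂ) - w + 3) * (12 * (lam : ℂ) - w + 5) / 144 - 1 / 18) *
            Eis 4 z ^ 3 + 384 * Disc z) * g z) =
        secondOrder (Eis 4 ^ 2) ((2 / 3 : ℂ) • (Eis 4 * Eis 6))
          (((((6 * n : ℤ) : ℂ) ^ 2 - 1) / 144 - 1 / 18) • Eis 4 ^ 3 + (384 : ℂ) • Disc) w := by
      ext g z
      simp [serreIter_two, secondOrder, hcoef]
      ring
    refine ⟨fun h => isBalancedQM_of_solution_four (hlt (by simp) h) (by omega) hf hc0
      (hop ▸ funext hsol), fun h => ?_⟩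
    obtain rfl : n = 0 := heq (by simp) h
    rw [hop, show (w - 4) / 12 = (L : ℤ) by omega]
    simpa only [zpow_natCast, Nat.cast_zero, mul_zero] using
      isFundamentalSystem_four L (by omega : w = 12 * L + 4)
end
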